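/- arXiv:1705.11043 — 8 statements merged into one kernel-verified Lean document; each statement's English description precedes it below -/
import Mathlib

section
/- Let T > 0, let K ∈ L¹([0,T]) with K ≥ 0 almost everywhere, let P : ℝ → ℝ be continuous and nondecreasing with P(x) ≥ 0 for all x ≥ 0, and let a ≥ 0. Suppose g ∈ L^∞([0,T]) satisfies g ≥ 0 and is a supersolution of the generalized nonlinear Volterra equation. Define the sequence g₀ = g, g_{n+1} = S[a, g_n]. Then 0 ≤ g_{n+1} ≤ g_n for all n ≥ 1, and (g_n) converges uniformly on [0,T] to a continuous function f⁺ satisfying f⁺(t) = a + ∫₀ᵗ K(t−s) P(f⁺(s)) ds for all t ∈ [0,T] and 0 ≤ f⁺ ≤ g. -/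
open MeasureTheory Set Filter

/-- A shifted and reflected integrable kernel times a bounded measurable function is integrable. -/
lemma integrable_kernel_mul {k h : ℝ → ℝ} {C : ℝ} (hk : Integrable k)
    (hh : AEStronglyMeasurable h) (hC : ∀ s, |h s| ≤ C) (t : ℝ) :
    Integrable fun s => k (t - s) * h s :=
  (hk.comp_sub_left t).mul_bdd hh (ae_of_all _ fun s => by simpa using hC s)

/-- The convolution of an integrable kernel with a bounded integrable function is continuous. -/
lemma continuous_integral_kernel_mul {k h : ℝ → ℝ} {C : ℝ} (hk : Integrable k)
    (hh : Integrable h) (hC : ∀ s, |h s| ≤ C) :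
    Continuous fun t => ∫ s, k (t - s) * h s := by
  have hC0 : 0 ≤ C := (abs_nonneg _).trans (hC 0)
  refine continuous_of_uniform_approx_of_continuous fun U hU => ?_
  obtain ⟨ε, hε, hεU⟩ := Metric.mem_uniformity_dist.1 hU
  obtain ⟨c, hcs, hcle, hcc, hci⟩ :=
    hk.exists_hasCompactSupport_integral_sub_le (ε := ε / (C + 1)) (by positivity)
  refine ⟨fun t => ∫ s, c (t - s) * h s, ?_, fun t => ?_⟩
  · obtain ⟨D, hD⟩ := hcs.exists_bound_of_continuous hcc
    refine continuous_of_dominated (bound := fun s => D * |h s|)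
      (fun t => ?_) (fun t => ?_) (hh.abs.const_mul D) (ae_of_all _ fun s => by fun_prop)
    · exact (integrable_kernel_mul hci hh.1 hC t).1
    · refine ae_of_all _ fun s => ?_
      rw [norm_mul]
      exact mul_le_mul_of_nonneg_right (hD _) (abs_nonneg _)
  · refine hεU ?_
    rw [Real.dist_eq, ← integral_sub (integrable_kernel_mul hk hh.1 hC t)
      (integrable_kernel_mul hci hh.1 hC t), ← Real.norm_eq_abs]
    have hdiff : Integrable fun s => ‖k (t - s) - c (t - s)‖ * C :=
      ((hk.sub hci).comp_sub_left t).norm.mul_const C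
    calc ‖∫ s, k (t - s) * h s - c (t - s) * h s‖
        ≤ ∫ s, ‖k (t - s) - c (t - s)‖ * C := by
          refine norm_integral_le_of_norm_le hdiff (ae_of_all _ fun s => ?_)
          rw [← sub_mul, norm_mul]
          exact mul_le_mul_of_nonneg_left (hC s) (norm_nonneg _)
      _ = (∫ s, ‖k s - c s‖) * C := by
          rw [integral_mul_const, integral_sub_left_eq_self (fun s => ‖k s - c s‖) volume t]
      _ ≤ ε / (C + 1) * C := mul_le_mul_of_nonneg_right hcle hC0
      _ < ε := by
          rw [div_mul_eq_mul_div, div_lt_iff₀ (by positivity)]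
          nlinarith

/-- A Volterra integral on `[0, T]` is a convolution on the whole line with a kernel that is
integrable and nonnegative everywhere. -/
lemma exists_nonneg_kernel_integral_eq {T : ℝ} {K : ℝ → ℝ} (hK : IntegrableOn K (Icc 0 T))
    (hK0 : ∀ᵐ s ∂(volume.restrict (Icc 0 T)), 0 ≤ K s) :
    ∃ k : ℝ → ℝ, Integrable k ∧ (∀ s, 0 ≤ k s) ∧ ∀ t ∈ Icc 0 T, ∀ φ : ℝ → ℝ,
      ∫ s in (0 : ℝ)..t, K (t - s) * φ s = ∫ s, k (t - s) * (Icc 0 T).indicator φ s := by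
  refine ⟨(Icc 0 T).indicator fun s => |K s|, (integrable_indicator_iff measurableSet_Icc).2 hK.abs,
    fun s => indicator_nonneg (fun _ _ => abs_nonneg _) s, fun t ht φ => ?_⟩
  rw [intervalIntegral.integral_of_le ht.1, ← integral_Icc_eq_integral_Ioc,
    ← integral_indicator measurableSet_Icc]
  refine integral_congr_ae ?_
  rw [ae_restrict_iff' measurableSet_Icc] at hK0
  filter_upwards [(Measure.measurePreserving_sub_left volume t).quasiMeasurePreserving.ae hK0]
    with s hs
  by_cases h0 : s ∈ Icc 0 t
  · have h1 : t - s ∈ Icc 0 T := ⟨by linarith [h0.2], by linarith [h0.1, ht.2]⟩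
    have h2 : s ∈ Icc 0 T := ⟨h0.1, h0.2.trans ht.2⟩
    rw [indicator_of_mem h0, indicator_of_mem h1, indicator_of_mem h2, abs_of_nonneg (hs h1)]
  · rw [indicator_of_notMem h0]
    by_cases h2 : s ∈ Icc 0 T
    · have h1 : t - s ∉ Icc 0 T := fun h => h0 ⟨h2.1, by linarith [h.1]⟩
      rw [indicator_of_notMem h1, zero_mul]
    · rw [indicator_of_notMem h2, mul_zero]

/-- Starting from a nonnegative bounded supersolution `g` of the generalized nonlinear
Volterra equation, the Picard iterates `g₀ = g`, `g_{n+1} = S[a, g_n]` satisfy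
`0 ≤ g_{n+1} ≤ g_n` (for `n ≥ 1`) and converge uniformly on `[0,T]` to a continuous
solution `f⁺` of the equation with `0 ≤ f⁺ ≤ g`. -/
theorem volterra_iterates_converge_to_solution
    (T : ℝ) (hT : 0 < T) (K : ℝ → ℝ)
    (hKint : IntegrableOn K (Icc (0:ℝ) T))
    (hKpos : ∀ᵐ s ∂(volume.restrict (Icc (0:ℝ) T)), 0 ≤ K s)
    (P : ℝ → ℝ) (hPcont : Continuous P) (hPmono : Monotone P)
    (hPnonneg : ∀ x : ℝ, 0 ≤ x → 0 ≤ P x)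
    (a : ℝ) (ha : 0 ≤ a)
    (g : ℝ → ℝ) (hgmeas : Measurable g)
    (hgbdd : ∃ M : ℝ, ∀ t ∈ Icc (0:ℝ) T, |g t| ≤ M)
    (hgnonneg : ∀ t ∈ Icc (0:ℝ) T, 0 ≤ g t)
    (hgsuper : ∀ t ∈ Icc (0:ℝ) T,
      a + (∫ s in (0:ℝ)..t, K (t - s) * P (g s)) ≤ g t)
    (gseq : ℕ → ℝ → ℝ) (hgseq0 : gseq 0 = g)
    (hgseqsucc : ∀ n : ℕ, ∀ t : ℝ,
      gseq (n + 1) t = a + ∫ s in (0:ℝ)..t, K (t - s) * P (gseq n s)) :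
    (∀ n : ℕ, 1 ≤ n → ∀ t ∈ Icc (0:ℝ) T,
        0 ≤ gseq (n + 1) t ∧ gseq (n + 1) t ≤ gseq n t) ∧
    ∃ fplus : ℝ → ℝ,
      ContinuousOn fplus (Icc (0:ℝ) T) ∧
      TendstoUniformlyOn gseq fplus atTop (Icc (0:ℝ) T) ∧
      (∀ t ∈ Icc (0:ℝ) T,
        fplus t = a + ∫ s in (0:ℝ)..t, K (t - s) * P (fplus s)) ∧
      (∀ t ∈ Icc (0:ℝ) T, 0 ≤ fplus t ∧ fplus t ≤ g t) := by
  obtain ⟨M, hM⟩ := hgbdd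
  obtain ⟨k, hk, hk0, hkeq⟩ := exists_nonneg_kernel_integral_eq hKint hKpos
  set I : Set ℝ := Icc 0 T
  let F : (ℝ → ℝ) → ℝ → ℝ := fun u => I.indicator fun s => P (u s)
  have hIm : MeasurableSet I := measurableSet_Icc
  -- measurable functions on `I` between `0` and `g`
  let A : (ℝ → ℝ) → Prop := fun u =>
    AEStronglyMeasurable u (volume.restrict I) ∧ ∀ t ∈ I, 0 ≤ u t ∧ u t ≤ g t
  have hF0 : ∀ u, A u → ∀ s, 0 ≤ F u s := fun u hu s =>
    indicator_nonneg (fun x hx => hPnonneg _ (hu.2 x hx).1) s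
  have hFle : ∀ u, A u → ∀ s, |F u s| ≤ |P M| := by
    intro u hu s
    rw [abs_of_nonneg (hF0 u hu s)]
    by_cases hs : s ∈ I
    · simp only [F, indicator_of_mem hs]
      exact (hPmono ((hu.2 s hs).2.trans ((le_abs_self _).trans (hM s hs)))).trans (le_abs_self _)
    · simp only [F, indicator_of_notMem hs, abs_nonneg]
  have hFm : ∀ u, A u → AEStronglyMeasurable (F u) := fun u hu =>
    (aestronglyMeasurable_indicator_iff hIm).2 (hPcont.comp_aestronglyMeasurable hu.1)
  have hFi : ∀ u, A u → Integrable (F u) := by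
    intro u hu
    refine (integrable_indicator_iff hIm).2
      ⟨(aestronglyMeasurable_indicator_iff hIm).1 (hFm u hu),
        .restrict_of_bounded (C := |P M|) measure_Icc_lt_top
          ((ae_restrict_iff' hIm).2 (ae_of_all _ fun s hs => ?_))⟩
    simpa only [F, indicator_of_mem hs, Real.norm_eq_abs] using hFle u hu s
  have hint : ∀ u, A u → ∀ t, Integrable fun s => k (t - s) * F u s := fun u hu t =>
    integrable_kernel_mul hk (hFm u hu) (hFle u hu) t
  have hcont : ∀ u, A u → Continuous fun t => a + ∫ s, k (t - s) * F u s := fun u hu =>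
    continuous_const.add (continuous_integral_kernel_mul hk (hFi u hu) (hFle u hu))
  have hmono : ∀ u v, A u → A v → (∀ t ∈ I, u t ≤ v t) → ∀ t,
      ∫ s, k (t - s) * F u s ≤ ∫ s, k (t - s) * F v s := by
    intro u v hu hv huv t
    refine integral_mono (hint u hu t) (hint v hv t) fun s => ?_
    exact mul_le_mul_of_nonneg_left
      (indicator_le_indicator' fun hs => hPmono (huv s hs)) (hk0 _)
  have hgA : A g := ⟨hgmeas.aestronglyMeasurable, fun t ht => ⟨hgnonneg t ht, le_rfl⟩⟩
  have hstep : ∀ n, ∀ t ∈ I, gseq (n + 1) t = a + ∫ s, k (t - s) * F (gseq n) s := by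
    intro n t ht
    rw [hgseqsucc, hkeq t ht]
  have hcontOn : ∀ n, A (gseq n) → ContinuousOn (gseq (n + 1)) I := fun n hn =>
    (hcont _ hn).continuousOn.congr (hstep n)
  have hA : ∀ n, A (gseq n) := by
    intro n
    induction n with
    | zero => rwa [hgseq0]
    | succ n ih =>
      refine ⟨(hcontOn n ih).aestronglyMeasurable hIm, fun t ht => ?_⟩
      rw [hstep n t ht]
      constructor
      · exact add_nonneg ha (integral_nonneg fun s => mul_nonneg (hk0 _) (hF0 _ ih s))
      · refine le_trans ?_ (hgsuper t ht)
        rw [hkeq t ht]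
        exact add_le_add_right (hmono _ _ ih hgA (fun s hs => (ih.2 s hs).2) t) a
  have hdec : ∀ n, ∀ t ∈ I, gseq (n + 1) t ≤ gseq n t := by
    intro n
    induction n with
    | zero =>
      intro t ht
      rw [hgseq0]
      exact ((hA 1).2 t ht).2
    | succ n ih =>
      intro t ht
      rw [hstep (n + 1) t ht, hstep n t ht]
      exact add_le_add_right (hmono _ _ (hA _) (hA _) ih t) a
  refine ⟨fun n _ t ht => ⟨((hA _).2 t ht).1, hdec n t ht⟩, fun t => ⨅ n, gseq n t, ?_⟩
  set f : ℝ → ℝ := fun t => ⨅ n, gseq n t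
  have hlim : ∀ t ∈ I, Tendsto (fun n => gseq n t) atTop (nhds (f t)) := fun t ht =>
    tendsto_atTop_ciInf (antitone_nat_of_succ_le fun n => hdec n t ht)
      ⟨0, by rintro _ ⟨n, rfl⟩; exact ((hA n).2 t ht).1⟩
  have hfA : A f := by
    refine ⟨aestronglyMeasurable_of_tendsto_ae atTop (fun n => (hA n).1)
      ((ae_restrict_iff' hIm).2 (ae_of_all _ hlim)), fun t ht => ⟨?_, ?_⟩⟩
    · exact ge_of_tendsto' (hlim t ht) fun n => ((hA n).2 t ht).1
    · exact le_of_tendsto' (hlim t ht) fun n => ((hA n).2 t ht).2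
  have hfix : ∀ t ∈ I, f t = a + ∫ s, k (t - s) * F f s := by
    intro t ht
    refine tendsto_nhds_unique ((tendsto_add_atTop_iff_nat 1).2 (hlim t ht)) ?_
    simp only [hstep _ t ht]
    refine tendsto_const_nhds.add (tendsto_integral_of_dominated_convergence
      (fun s => k (t - s) * |P M|) (fun n => (hint _ (hA n) t).1)
      ((hk.comp_sub_left t).mul_const _) (fun n => ae_of_all _ fun s => ?_)
      (ae_of_all _ fun s => ?_))
    · rw [norm_mul, Real.norm_of_nonneg (hk0 _)]
      exact mul_le_mul_of_nonneg_left (hFle _ (hA n) s) (hk0 _)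
    · refine Tendsto.const_mul _ ?_
      by_cases hs : s ∈ I
      · simp only [F, indicator_of_mem hs]
        exact (hPcont.tendsto _).comp (hlim s hs)
      · simp only [F, indicator_of_notMem hs, tendsto_const_nhds]
  have hfc : ContinuousOn f I := (hcont f hfA).continuousOn.congr hfix
  refine ⟨hfc, ?_, fun t ht => by rw [hkeq t ht]; exact hfix t ht, hfA.2⟩
  have hdini : TendstoUniformlyOn (fun n => gseq (n + 1)) f atTop I :=
    Antitone.tendstoUniformlyOn_of_forall_tendsto isCompact_Icc (fun n => hcontOn n (hA n))
      (fun t ht => antitone_nat_of_succ_le fun n => hdec (n + 1) t ht) hfc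
      fun t ht => (tendsto_add_atTop_iff_nat 1).2 (hlim t ht)
  intro U hU
  have h := hdini U hU
  rwa [← map_add_atTop_eq_nat 1, eventually_map]
end

section
/- Let T > 0, let K ∈ L¹([0,T]) with K ≥ 0 almost everywhere, let P : ℝ → ℝ be continuous and nondecreasing with P(x) ≥ 0 for all x ≥ 0, and let a ≥ 0. Then there exist τ ∈ (0,T] and a continuous function f : [0,τ] → [0,∞) such that f(t) = a + ∫₀ᵗ K(t−s) P(f(s)) ds for all t ∈ [0,τ]. -/
open MeasureTheory Set

/-- The convolution of an integrable function with a bounded measurable function is continuous. -/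
theorem continuous_integral_sub_mul_of_bounded {k u : ℝ → ℝ} {C : ℝ}
    (hk : Integrable k) (hu : Measurable u) (huC : ∀ s, |u s| ≤ C) :
    Continuous fun t => ∫ s, k (t - s) * u s := by
  have hC : 0 ≤ C := (abs_nonneg _).trans (huC 0)
  have hint : ∀ {h : ℝ → ℝ}, Integrable h → ∀ t, Integrable fun s => h (t - s) * u s :=
    fun hh t => (hh.comp_sub_left t).mul_bdd (c := C) hu.aestronglyMeasurable
      (Filter.Eventually.of_forall huC)
  refine continuous_of_uniform_approx_of_continuous fun V hV => ?_
  obtain ⟨ε, hε, hεV⟩ := Metric.mem_uniformity_dist.1 hV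
  obtain ⟨h, hsupp, hdist, hcont, hhint⟩ :=
    hk.exists_hasCompactSupport_integral_sub_le (ε := ε / (C + 1) / 2) (by positivity)
  refine ⟨fun t => ∫ s, h (t - s) * u s, ?_, fun t => hεV ?_⟩
  · have hloc : LocallyIntegrable u := by
      refine (locallyIntegrable_const C).mono hu.aestronglyMeasurable
        (Filter.Eventually.of_forall fun s => ?_)
      simpa [abs_of_nonneg hC] using huC s
    have := hsupp.continuous_convolution_left (ContinuousLinearMap.mul ℝ ℝ) hcont hloc
      (μ := volume)
    convert this using 2 with t
    rw [convolution_eq_swap]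
    rfl
  · rw [Real.dist_eq, ← integral_sub (hint hk t) (hint hhint t)]
    have hbound : ∀ s, ‖k (t - s) * u s - h (t - s) * u s‖ ≤ ‖k (t - s) - h (t - s)‖ * C := by
      intro s
      rw [← sub_mul, norm_mul]
      exact mul_le_mul_of_nonneg_left (huC s) (norm_nonneg _)
    have hdiff : Integrable fun s => ‖k (t - s) - h (t - s)‖ * C :=
      (((hk.sub hhint).comp_sub_left t).norm).mul_const C
    calc |∫ s, k (t - s) * u s - h (t - s) * u s|
        ≤ ∫ s, ‖k (t - s) - h (t - s)‖ * C :=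
          norm_integral_le_of_norm_le hdiff (Filter.Eventually.of_forall hbound)
      _ = (∫ s, ‖k s - h s‖) * C := by
          rw [integral_mul_const, integral_sub_left_eq_self (fun s => ‖k s - h s‖) volume t]
      _ ≤ ε / (C + 1) / 2 * C := mul_le_mul_of_nonneg_right hdist hC
      _ < ε := by
          rw [div_div, div_mul_eq_mul_div, div_lt_iff₀ (by positivity)]
          nlinarith

/-- An integrable nonnegative kernel of small enough mass admits a bounded nonnegative continuous
solution of the Volterra equation, written as a convolution on the whole line. -/
theorem exists_continuous_convolution_fixedPoint {k P : ℝ → ℝ} {a M : ℝ}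
    (hk : Integrable k) (hk0 : ∀ s, 0 ≤ k s)
    (hPcont : Continuous P) (hPmono : Monotone P) (hPnonneg : ∀ x : ℝ, 0 ≤ x → 0 ≤ P x)
    (ha : 0 ≤ a) (hM : 0 ≤ M) (hsmall : a + (∫ s, k s) * P M ≤ M) :
    ∃ f : ℝ → ℝ, Continuous f ∧ (∀ t, 0 ≤ f t) ∧
      ∀ t, f t = a + ∫ s, k (t - s) * (Ici (0 : ℝ)).indicator (fun s => P (f s)) s := by
  set u : (ℝ → ℝ) → ℝ → ℝ := fun g => (Ici (0 : ℝ)).indicator fun s => P (g s) with hu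
  set Φ : (ℝ → ℝ) → ℝ → ℝ := fun g t => a + ∫ s, k (t - s) * u g s
  have hPM : 0 ≤ P M := hPnonneg M hM
  have u_meas : ∀ {g : ℝ → ℝ}, Measurable g → Measurable (u g) := fun hg =>
    (hPcont.measurable.comp hg).indicator measurableSet_Ici
  have u_nonneg : ∀ {g : ℝ → ℝ}, (∀ t, 0 ≤ g t) → ∀ s, 0 ≤ u g s := fun hg s =>
    indicator_nonneg (fun s _ => hPnonneg _ (hg s)) s
  have u_le : ∀ {g : ℝ → ℝ}, (∀ t, g t ≤ M) → ∀ s, u g s ≤ P M := fun hg s =>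
    indicator_le' (fun s _ => hPmono (hg s)) (fun _ _ => hPM) s
  have u_abs : ∀ {g : ℝ → ℝ}, (∀ t, 0 ≤ g t) → (∀ t, g t ≤ M) → ∀ s, |u g s| ≤ P M :=
    fun h0 h1 s => by rw [abs_of_nonneg (u_nonneg h0 s)]; exact u_le h1 s
  have hint : ∀ {g : ℝ → ℝ}, Measurable g → (∀ t, 0 ≤ g t) → (∀ t, g t ≤ M) →
      ∀ t, Integrable fun s => k (t - s) * u g s := fun hg h0 h1 t =>
    (hk.comp_sub_left t).mul_bdd (c := P M) (u_meas hg).aestronglyMeasurable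
      (Filter.Eventually.of_forall (u_abs h0 h1))
  have Φ_cont : ∀ {g : ℝ → ℝ}, Measurable g → (∀ t, 0 ≤ g t) → (∀ t, g t ≤ M) →
      Continuous (Φ g) := fun hg h0 h1 =>
    continuous_const.add (continuous_integral_sub_mul_of_bounded hk (u_meas hg) (u_abs h0 h1))
  have Φ_nonneg : ∀ {g : ℝ → ℝ}, (∀ t, 0 ≤ g t) → ∀ t, 0 ≤ Φ g t := fun h0 t =>
    add_nonneg ha (integral_nonneg fun s => mul_nonneg (hk0 _) (u_nonneg h0 s))
  have Φ_le : ∀ {g : ℝ → ℝ}, Measurable g → (∀ t, 0 ≤ g t) → (∀ t, g t ≤ M) →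
      ∀ t, Φ g t ≤ M := by
    intro g hg h0 h1 t
    refine le_trans ?_ hsmall
    have : ∫ s, k (t - s) * u g s ≤ ∫ s, k (t - s) * P M :=
      integral_mono (hint hg h0 h1 t) ((hk.comp_sub_left t).mul_const _)
        fun s => mul_le_mul_of_nonneg_left (u_le h1 s) (hk0 _)
    rw [integral_mul_const, integral_sub_left_eq_self k volume t] at this
    exact add_le_add_right this a
  set F : ℕ → ℝ → ℝ := fun n => Φ^[n] 0
  have F_succ : ∀ n, F (n + 1) = Φ (F n) := fun n => Function.iterate_succ_apply' Φ n 0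
  have F_inv : ∀ n, Measurable (F n) ∧ (∀ t, 0 ≤ F n t) ∧ ∀ t, F n t ≤ M := by
    intro n
    induction n with
    | zero => exact ⟨measurable_const, fun _ => le_rfl, fun _ => hM⟩
    | succ n ih =>
      rw [F_succ]
      obtain ⟨hg, h0, h1⟩ := ih
      exact ⟨(Φ_cont hg h0 h1).measurable, Φ_nonneg h0, Φ_le hg h0 h1⟩
  have F_step : ∀ n t, F n t ≤ F (n + 1) t := by
    intro n
    induction n with
    | zero => exact fun t => (F_inv 1).2.1 t
    | succ n ih =>
      intro t
      rw [F_succ (n + 1), F_succ n]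
      obtain ⟨hg, h0, h1⟩ := F_inv n
      have h' := F_inv (n + 1)
      rw [F_succ n] at h' ih
      refine add_le_add_right (integral_mono (hint hg h0 h1 t) (hint h'.1 h'.2.1 h'.2.2 t)
        fun s => mul_le_mul_of_nonneg_left ?_ (hk0 _)) a
      exact indicator_le_indicator (hPmono (ih s))
  have F_tendsto : ∀ t, Filter.Tendsto (fun n => F n t) Filter.atTop (nhds (⨆ n, F n t)) :=
    fun t => tendsto_atTop_ciSup (monotone_nat_of_le_succ fun n => F_step n t)
      ⟨M, by rintro _ ⟨n, rfl⟩; exact (F_inv n).2.2 t⟩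
  set f : ℝ → ℝ := fun t => ⨆ n, F n t
  have f_meas : Measurable f :=
    measurable_of_tendsto_metrizable (fun n => (F_inv n).1) (tendsto_pi_nhds.2 F_tendsto)
  have f_nonneg : ∀ t, 0 ≤ f t := fun t => ge_of_tendsto' (F_tendsto t) fun n => (F_inv n).2.1 t
  have f_le : ∀ t, f t ≤ M := fun t => le_of_tendsto' (F_tendsto t) fun n => (F_inv n).2.2 t
  have f_eq : ∀ t, f t = Φ f t := by
    intro t
    refine tendsto_nhds_unique ((F_tendsto t).comp (Filter.tendsto_add_atTop_nat 1)) ?_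
    have : (fun n => F n t) ∘ (fun n => n + 1) = fun n => Φ (F n) t :=
      funext fun n => congrFun (F_succ n) t
    rw [this]
    refine tendsto_const_nhds.add (tendsto_integral_of_dominated_convergence
      (fun s => k (t - s) * P M)
      (fun n => (hint (F_inv n).1 (F_inv n).2.1 (F_inv n).2.2 t).aestronglyMeasurable)
      ((hk.comp_sub_left t).mul_const _) (fun n => Filter.Eventually.of_forall fun s => ?_)
      (Filter.Eventually.of_forall fun s => Filter.Tendsto.const_mul _ ?_))
    · rw [norm_mul, Real.norm_of_nonneg (hk0 _)]
      exact mul_le_mul_of_nonneg_left (u_abs (F_inv n).2.1 (F_inv n).2.2 s) (hk0 _)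
    · by_cases hs : s ∈ Ici (0 : ℝ)
      · simp only [hu, indicator_of_mem hs]
        exact (hPcont.tendsto _).comp (F_tendsto s)
      · simp only [hu, indicator_of_notMem hs, tendsto_const_nhds]
  refine ⟨f, ?_, f_nonneg, f_eq⟩
  rw [show f = Φ f from funext f_eq]
  exact Φ_cont f_meas f_nonneg f_le

/-- Local-in-time existence of a continuous nonnegative solution of the generalized
nonlinear Volterra equation `f(t) = a + ∫₀ᵗ K(t−s) P(f(s)) ds`. -/
theorem volterra_local_existence
    (T : ℝ) (hT : 0 < T) (K : ℝ → ℝ)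
    (hKint : IntegrableOn K (Icc (0:ℝ) T))
    (hKpos : ∀ᵐ s ∂(volume.restrict (Icc (0:ℝ) T)), 0 ≤ K s)
    (P : ℝ → ℝ) (hPcont : Continuous P) (hPmono : Monotone P)
    (hPnonneg : ∀ x : ℝ, 0 ≤ x → 0 ≤ P x)
    (a : ℝ) (ha : 0 ≤ a) :
    ∃ τ ∈ Ioc (0:ℝ) T, ∃ f : ℝ → ℝ,
      ContinuousOn f (Icc (0:ℝ) τ) ∧
      (∀ t ∈ Icc (0:ℝ) τ, 0 ≤ f t) ∧
      (∀ t ∈ Icc (0:ℝ) τ,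
        f t = a + ∫ s in (0:ℝ)..t, K (t - s) * P (f s)) := by
  set κ : ℝ → ℝ := (Icc (0 : ℝ) T).indicator fun s => max (K s) 0 with hκ
  have κ_nonneg : ∀ s, 0 ≤ κ s := indicator_nonneg fun s _ => le_max_right _ _
  have κ_int : Integrable κ :=
    (integrable_indicator_iff measurableSet_Icc).2 (Integrable.pos_part hKint)
  have κ_eq : ∀ᵐ s, s ∈ Icc (0 : ℝ) T → κ s = K s := by
    filter_upwards [(ae_restrict_iff' measurableSet_Icc).1 hKpos] with s hs hsT
    rw [hκ, indicator_of_mem hsT, max_eq_left (hs hsT)]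
  obtain ⟨τ, hτ, hτ1⟩ : ∃ τ ∈ Ioc (0 : ℝ) T, (∫ s in (0 : ℝ)..τ, κ s) * P (a + 1) < 1 := by
    have hcont : Continuous fun x => (∫ s in (0 : ℝ)..x, κ s) * P (a + 1) :=
      (intervalIntegral.continuous_primitive (fun _ _ => κ_int.intervalIntegrable) 0).mul
        continuous_const
    have hev : ∀ᶠ x in nhdsWithin 0 (Ioi (0 : ℝ)), (∫ s in (0 : ℝ)..x, κ s) * P (a + 1) < 1 :=
      (hcont.tendsto 0).mono_left nhdsWithin_le_nhds |>.eventually_lt_const (by simp)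
    obtain ⟨τ, h1, h2⟩ := (hev.and (Ioc_mem_nhdsGT hT)).exists
    exact ⟨τ, h2, h1⟩
  have hmass : ∫ s, (Ioc 0 τ).indicator κ s = ∫ s in (0 : ℝ)..τ, κ s := by
    rw [integral_indicator measurableSet_Ioc, intervalIntegral.integral_of_le hτ.1.le]
  obtain ⟨f, f_cont, f_nonneg, f_eq⟩ := exists_continuous_convolution_fixedPoint
    (k := (Ioc 0 τ).indicator κ) (M := a + 1) (κ_int.indicator measurableSet_Ioc)
    (indicator_nonneg fun s _ => κ_nonneg s) hPcont hPmono hPnonneg ha (by positivity)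
    (by rw [hmass]; linarith)
  refine ⟨τ, hτ, f, f_cont.continuousOn, fun t _ => f_nonneg t, fun t ht => ?_⟩
  rw [f_eq t, intervalIntegral.integral_of_le ht.1, ← integral_indicator measurableSet_Ioc]
  congr 1
  refine integral_congr_ae ?_
  have hae := (Measure.measurePreserving_sub_left volume t).quasiMeasurePreserving.ae κ_eq
  filter_upwards [hae, Measure.ae_ne volume 0, Measure.ae_ne volume t] with s hs hs0 hst
  by_cases hmem : s ∈ Ioc 0 t
  · have hlt : s < t := lt_of_le_of_ne hmem.2 hst
    have h1 : t - s ∈ Ioc 0 τ := ⟨by linarith, by linarith [hmem.1, ht.2]⟩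
    rw [indicator_of_mem hmem, indicator_of_mem h1, indicator_of_mem (mem_Ici.2 hmem.1.le),
      hs ⟨h1.1.le, h1.2.trans hτ.2⟩]
  · rw [indicator_of_notMem hmem]
    by_cases h0 : 0 < s
    · rw [indicator_of_notMem fun h => hmem ⟨h0, by linarith [h.1]⟩, zero_mul]
    · rw [indicator_of_notMem fun h : s ∈ Ici 0 => h0 (lt_of_le_of_ne h hs0.symm), mul_zero]
end

section
/- Let T > 0, let K ∈ L¹([0,T]) with K ≥ 0 almost everywhere, and let L ≥ 0. If ε : [0,T] → ℝ is continuous and satisfies 0 ≤ ε(t) ≤ L·∫₀ᵗ K(t−s) ε(s) ds for every t ∈ [0,T], then ε(t) = 0 for all t ∈ [0,T]. -/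
open MeasureTheory Set

open Filter Topology in
/-- The Laplace transform of a function integrable on `[0,T]` vanishes at infinity. -/
theorem tendsto_integral_mul_exp_neg_nat_mul {T : ℝ} {K : ℝ → ℝ}
    (hK : IntegrableOn K (Ioc (0:ℝ) T)) :
    Tendsto (fun n : ℕ => ∫ r in Ioc (0:ℝ) T, K r * Real.exp (-(n * r))) atTop (𝓝 0) := by
  have key : Tendsto (fun n : ℕ => ∫ r in Ioc (0:ℝ) T, K r * Real.exp (-(n * r))) atTop
      (𝓝 (∫ _ in Ioc (0:ℝ) T, (0:ℝ))) := by
    refine tendsto_integral_of_dominated_convergence (fun r => ‖K r‖) (fun n => ?_) hK.norm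
      (fun n => ?_) ?_
    · exact hK.aestronglyMeasurable.mul (by fun_prop : Continuous _).aestronglyMeasurable
    · filter_upwards [ae_restrict_mem measurableSet_Ioc] with r hr
      rw [norm_mul, Real.norm_of_nonneg (Real.exp_pos _).le]
      refine mul_le_of_le_one_right (norm_nonneg _) (Real.exp_le_one_iff.2 ?_)
      have : 0 ≤ (n : ℝ) * r := mul_nonneg n.cast_nonneg hr.1.le
      linarith
    · filter_upwards [ae_restrict_mem measurableSet_Ioc] with r hr
      have h : Tendsto (fun n : ℕ => Real.exp (-(n * r))) atTop (𝓝 0) :=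
        Real.tendsto_exp_neg_atTop_nhds_zero.comp
          (tendsto_natCast_atTop_atTop.atTop_mul_const hr.1)
      simpa using h.const_mul (K r)
  simpa using key

/-- Gronwall-type uniqueness lemma: if `ε` is continuous, nonnegative on `[0,T]` and
satisfies `ε(t) ≤ L ∫₀ᵗ K(t−s) ε(s) ds` with `K ∈ L¹([0,T])`, `K ≥ 0` a.e., `L ≥ 0`,
then `ε ≡ 0` on `[0,T]`. -/
theorem volterra_gronwall_zero
    (T : ℝ) (hT : 0 < T) (K : ℝ → ℝ)
    (hKint : IntegrableOn K (Icc (0:ℝ) T))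
    (hKpos : ∀ᵐ s ∂(volume.restrict (Icc (0:ℝ) T)), 0 ≤ K s)
    (L : ℝ) (hL : 0 ≤ L)
    (ε : ℝ → ℝ) (hεcont : ContinuousOn ε (Icc (0:ℝ) T))
    (hε : ∀ t ∈ Icc (0:ℝ) T,
      0 ≤ ε t ∧ ε t ≤ L * ∫ s in (0:ℝ)..t, K (t - s) * ε s) :
    ∀ t ∈ Icc (0:ℝ) T, ε t = 0 := by
  have hKioc : IntegrableOn K (Ioc (0:ℝ) T) := hKint.mono_set Ioc_subset_Icc_self
  obtain ⟨n, hn⟩ : ∃ n : ℕ, L * ∫ r in Ioc (0:ℝ) T, K r * Real.exp (-(n * r)) < 1 := by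
    have h := (tendsto_integral_mul_exp_neg_nat_mul hKioc).const_mul L
    rw [mul_zero] at h
    exact (h.eventually_lt_const one_pos).exists
  set q := ∫ r in Ioc (0:ℝ) T, K r * Real.exp (-(n * r))
  -- Maximise the exponentially weighted function.
  obtain ⟨t₀, ht₀, hmax⟩ := isCompact_Icc.exists_isMaxOn (nonempty_Icc.2 hT.le)
    (f := fun t => Real.exp (-(n * t)) * ε t)
    ((by fun_prop : Continuous fun t : ℝ => Real.exp (-(n * t))).continuousOn.mul hεcont)
  set M := Real.exp (-(n * t₀)) * ε t₀
  have hM0 : 0 ≤ M := mul_nonneg (Real.exp_pos _).le (hε t₀ ht₀).1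
  have hbound : ∀ t ∈ Icc (0:ℝ) T, ε t ≤ M * Real.exp (n * t) := fun t ht => by
    have h : Real.exp (-(n * t)) * ε t ≤ M := hmax ht
    rwa [Real.exp_neg, inv_mul_eq_div, div_le_iff₀ (Real.exp_pos _)] at h
  have hsub : Ioc 0 t₀ ⊆ Ioc 0 T := Ioc_subset_Ioc_right ht₀.2
  have hKpos' : ∀ᵐ r ∂volume.restrict (Ioc (0:ℝ) T), 0 ≤ K r :=
    ae_restrict_of_ae_restrict_of_subset Ioc_subset_Icc_self hKpos
  have hintT : IntegrableOn (fun r => K r * Real.exp (-(n * r))) (Ioc 0 T) :=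
    (hKint.mul_continuousOn (by fun_prop) isCompact_Icc).mono_set Ioc_subset_Icc_self
  have hconv : ∫ s in (0:ℝ)..t₀, K (t₀ - s) * ε s ≤ M * Real.exp (n * t₀) * q := by
    have hsubst : ∫ s in (0:ℝ)..t₀, K (t₀ - s) * ε s = ∫ r in Ioc 0 t₀, K r * ε (t₀ - r) := by
      have h := intervalIntegral.integral_comp_sub_left (a := 0) (b := t₀)
        (fun r => K r * ε (t₀ - r)) t₀
      simp only [sub_sub_cancel, sub_self, sub_zero] at h
      rw [h, intervalIntegral.integral_of_le ht₀.1]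
    have hint : IntegrableOn (fun r => K r * ε (t₀ - r)) (Ioc 0 t₀) := by
      refine IntegrableOn.mono_set ?_ Ioc_subset_Icc_self
      refine (hKint.mono_set (Icc_subset_Icc_right ht₀.2)).mul_continuousOn ?_ isCompact_Icc
      exact hεcont.comp (by fun_prop) fun r hr =>
        ⟨sub_nonneg.2 hr.2, (sub_le_self _ hr.1).trans ht₀.2⟩
    calc ∫ s in (0:ℝ)..t₀, K (t₀ - s) * ε s
        = ∫ r in Ioc 0 t₀, K r * ε (t₀ - r) := hsubst
      _ ≤ ∫ r in Ioc 0 t₀, M * Real.exp (n * t₀) * (K r * Real.exp (-(n * r))) := by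
          refine integral_mono_ae hint ((hintT.mono_set hsub).const_mul _) ?_
          filter_upwards [ae_restrict_mem measurableSet_Ioc,
            ae_restrict_of_ae_restrict_of_subset hsub hKpos'] with r hr hKr
          calc K r * ε (t₀ - r) ≤ K r * (M * Real.exp (n * (t₀ - r))) :=
                mul_le_mul_of_nonneg_left
                  (hbound _ ⟨sub_nonneg.2 hr.2, (sub_le_self _ hr.1.le).trans ht₀.2⟩) hKr
            _ = M * Real.exp (n * t₀) * (K r * Real.exp (-(n * r))) := by
                rw [mul_sub, sub_eq_add_neg, Real.exp_add]; ring
      _ = M * Real.exp (n * t₀) * ∫ r in Ioc 0 t₀, K r * Real.exp (-(n * r)) :=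
          integral_const_mul _ _
      _ ≤ M * Real.exp (n * t₀) * q := by
          refine mul_le_mul_of_nonneg_left ?_ (mul_nonneg hM0 (Real.exp_pos _).le)
          refine setIntegral_mono_set hintT ?_ hsub.eventuallyLE
          filter_upwards [hKpos'] with r hr using mul_nonneg hr (Real.exp_pos _).le
  have hMq : M ≤ M * (L * q) :=
    calc M ≤ Real.exp (-(n * t₀)) * (L * (M * Real.exp (n * t₀) * q)) :=
          mul_le_mul_of_nonneg_left
            ((hε t₀ ht₀).2.trans (mul_le_mul_of_nonneg_left hconv hL)) (Real.exp_pos _).le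
      _ = (Real.exp (-(n * t₀)) * Real.exp (n * t₀)) * (M * (L * q)) := by ring
      _ = M * (L * q) := by rw [← Real.exp_add, neg_add_cancel, Real.exp_zero, one_mul]
  have hMzero : M = 0 := by nlinarith
  intro t ht
  have h := hbound t ht
  rw [hMzero, zero_mul] at h
  exact le_antisymm h (hε t ht).1
end

section
/- Let T > 0, let K ∈ L¹([0,T]) with K ≥ 0 almost everywhere, let a ≥ 0, and let P : ℝ → ℝ be nondecreasing and Lipschitz continuous. If f, g : [0,T] → ℝ are continuous functions that both satisfy the generalized nonlinear Volterra equation, i.e. f(t) = a + ∫₀ᵗ K(t−s) P(f(s)) ds and g(t) = a + ∫₀ᵗ K(t−s) P(g(s)) ds for all t ∈ [0,T], then f = g on [0,T]. -/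
open MeasureTheory Set

/-- The Laplace transform of an integrable function on `[0, T]` tends to zero at infinity. -/
theorem tendsto_intervalIntegral_exp_neg_mul_abs {T : ℝ} (hT : 0 ≤ T) {K : ℝ → ℝ}
    (hK : IntervalIntegrable K volume 0 T) :
    Filter.Tendsto (fun c : ℝ => ∫ u in (0:ℝ)..T, Real.exp (-(c * u)) * |K u|)
      Filter.atTop (nhds 0) := by
  have key := intervalIntegral.tendsto_integral_filter_of_dominated_convergence
    (μ := volume) (a := 0) (b := T) (l := Filter.atTop)
    (F := fun c u : ℝ => Real.exp (-(c * u)) * |K u|) (f := fun _ => 0)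
    (fun u => |K u|) ?_ ?_ hK.abs ?_
  · simpa using key
  · refine Filter.Eventually.of_forall fun c => ?_
    exact (by fun_prop : Continuous fun u : ℝ => Real.exp (-(c * u))).aestronglyMeasurable.mul
      hK.abs.def'.aestronglyMeasurable
  · filter_upwards [Filter.eventually_ge_atTop 0] with c hc
    refine Filter.Eventually.of_forall fun u hu => ?_
    rw [uIoc_of_le hT] at hu
    rw [Real.norm_eq_abs, abs_mul, abs_abs, Real.abs_exp]
    refine mul_le_of_le_one_left (abs_nonneg _) (Real.exp_le_one_iff.2 ?_)
    exact neg_nonpos.2 (mul_nonneg hc hu.1.le)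
  · refine Filter.Eventually.of_forall fun u hu => ?_
    rw [uIoc_of_le hT] at hu
    simpa using (Real.tendsto_exp_neg_atTop_nhds_zero.comp
      (Filter.tendsto_id.atTop_mul_const hu.1)).mul_const |K u|

/-- Uniqueness of continuous solutions of the generalized nonlinear Volterra equation
when the nonlinearity `P` is nondecreasing and Lipschitz continuous. -/
theorem volterra_uniqueness
    (T : ℝ) (hT : 0 < T) (K : ℝ → ℝ)
    (hKint : IntegrableOn K (Icc (0:ℝ) T))
    (hKpos : ∀ᵐ s ∂(volume.restrict (Icc (0:ℝ) T)), 0 ≤ K s)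
    (a : ℝ) (ha : 0 ≤ a)
    (P : ℝ → ℝ) (hPmono : Monotone P) (L : NNReal) (hPlip : LipschitzWith L P)
    (f g : ℝ → ℝ)
    (hfcont : ContinuousOn f (Icc (0:ℝ) T))
    (hgcont : ContinuousOn g (Icc (0:ℝ) T))
    (hf : ∀ t ∈ Icc (0:ℝ) T,
      f t = a + ∫ s in (0:ℝ)..t, K (t - s) * P (f s))
    (hg : ∀ t ∈ Icc (0:ℝ) T,
      g t = a + ∫ s in (0:ℝ)..t, K (t - s) * P (g s)) :
    ∀ t ∈ Icc (0:ℝ) T, f t = g t := by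
  have hK : IntervalIntegrable K volume 0 T :=
    (intervalIntegrable_iff_integrableOn_Icc_of_le hT.le).2 hKint
  obtain ⟨c, hc⟩ := (((tendsto_intervalIntegral_exp_neg_mul_abs hT.le hK).const_mul
    (L : ℝ)).eventually_lt_const (by simp : (L : ℝ) * 0 < 1)).exists
  -- Compare `f` and `g` at a maximum of the exponentially weighted difference.
  obtain ⟨t, ht, hmax⟩ := isCompact_Icc.exists_isMaxOn (nonempty_Icc.2 hT.le)
    (f := fun s => Real.exp (-(c * s)) * |f s - g s|)
    ((by fun_prop : Continuous fun s : ℝ => Real.exp (-(c * s))).continuousOn.mul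
      (hfcont.sub hgcont).abs)
  set M := Real.exp (-(c * t)) * |f t - g t| with hM
  have hM0 : 0 ≤ M := by positivity
  have hle : ∀ s ∈ Icc (0:ℝ) T, |f s - g s| ≤ Real.exp (c * s) * M := by
    intro s hs
    have h : Real.exp (-(c * s)) * |f s - g s| ≤ M := hmax hs
    calc |f s - g s| = Real.exp (c * s) * (Real.exp (-(c * s)) * |f s - g s|) := by
          rw [← mul_assoc, ← Real.exp_add]; simp
      _ ≤ Real.exp (c * s) * M := by gcongr
  have hsub : Icc 0 t ⊆ Icc 0 T := Icc_subset_Icc_right ht.2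
  have hKt : IntervalIntegrable K volume 0 t := hK.mono_set (by
    rwa [uIcc_of_le ht.1, uIcc_of_le hT.le])
  have hKr : IntervalIntegrable (fun s => K (t - s)) volume 0 t := by
    simpa using (hKt.comp_sub_left t).symm
  have hint : ∀ w : ℝ → ℝ, ContinuousOn w (Icc 0 T) →
      IntervalIntegrable (fun s => K (t - s) * P (w s)) volume 0 t := fun w hw =>
    hKr.mul_continuousOn (by
      rw [uIcc_of_le ht.1]
      exact hPlip.continuous.comp_continuousOn (hw.mono hsub))
  have hEK : ∀ {b : ℝ}, IntervalIntegrable K volume 0 b →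
      IntervalIntegrable (fun u => Real.exp (-(c * u)) * |K u|) volume 0 b := fun h =>
    h.abs.continuousOn_mul (by fun_prop)
  have hdiff : f t - g t = ∫ s in (0:ℝ)..t, (K (t - s) * P (f s) - K (t - s) * P (g s)) := by
    rw [intervalIntegral.integral_sub (hint f hfcont) (hint g hgcont), hf t ht, hg t ht]
    ring
  have hbound : |f t - g t| ≤ ∫ s in (0:ℝ)..t,
      Real.exp (-(c * (t - s))) * |K (t - s)| * (L * Real.exp (c * t) * M) := by
    rw [hdiff, ← Real.norm_eq_abs]
    refine intervalIntegral.norm_integral_le_of_norm_le ht.1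
      (Filter.Eventually.of_forall fun s hs => ?_) ?_
    · have hP : |P (f s) - P (g s)| ≤ L * |f s - g s| := by
        simpa [Real.dist_eq] using hPlip.dist_le_mul (f s) (g s)
      have hexp : Real.exp (c * s) = Real.exp (-(c * (t - s))) * Real.exp (c * t) := by
        rw [← Real.exp_add]; ring_nf
      rw [← mul_sub, Real.norm_eq_abs, abs_mul]
      calc |K (t - s)| * |P (f s) - P (g s)|
          ≤ |K (t - s)| * (L * (Real.exp (c * s) * M)) := by
            gcongr
            exact hP.trans (by gcongr; exact hle s (hsub ⟨hs.1.le, hs.2⟩))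
        _ = _ := by rw [hexp]; ring
    · have h := ((hEK hKt).comp_sub_left t).symm
      simp only [sub_zero, sub_self] at h
      exact h.mul_const _
  rw [intervalIntegral.integral_mul_const,
    intervalIntegral.integral_comp_sub_left (fun u => Real.exp (-(c * u)) * |K u|) t,
    sub_self, sub_zero] at hbound
  have hmono : ∫ u in (0:ℝ)..t, Real.exp (-(c * u)) * |K u| ≤
      ∫ u in (0:ℝ)..T, Real.exp (-(c * u)) * |K u| :=
    intervalIntegral.integral_mono_interval le_rfl ht.1 ht.2
      (Filter.Eventually.of_forall fun u => by positivity) (hEK hK)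
  have hcontr : M ≤ (L * ∫ u in (0:ℝ)..T, Real.exp (-(c * u)) * |K u|) * M := by
    calc M ≤ Real.exp (-(c * t)) * ((∫ u in (0:ℝ)..T, Real.exp (-(c * u)) * |K u|) *
          (L * Real.exp (c * t) * M)) := by
          rw [hM]
          gcongr
          exact hbound.trans (by gcongr)
      _ = (Real.exp (-(c * t)) * Real.exp (c * t)) *
          ((L * ∫ u in (0:ℝ)..T, Real.exp (-(c * u)) * |K u|) * M) := by ring
      _ = _ := by rw [← Real.exp_add]; simp
  have hMzero : M = 0 := by nlinarith
  intro s hs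
  have h := hle s hs
  rw [hMzero, mul_zero] at h
  exact sub_eq_zero.1 (abs_nonpos_iff.1 h)
end

section
/- (V-maximum principle) Let T > 0, let K ∈ L¹([0,T]) with K ≥ 0 almost everywhere, let a ≥ 0, and let P : ℝ → ℝ be nondecreasing and Lipschitz continuous. Let f ∈ L^∞([0,T]) be a subsolution of the generalized nonlinear Volterra equation, i.e. f(t) ≤ a + ∫₀ᵗ K(t−s) P(f(s)) ds for all t ∈ [0,T], and let g ∈ L^∞([0,T]) be a supersolution, i.e. a + ∫₀ᵗ K(t−s) P(g(s)) ds ≤ g(t) for all t ∈ [0,T]. Then f(t) ≤ g(t) for all t ∈ [0,T]. -/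
open MeasureTheory Set

open Filter Topology

/-- The Laplace transform over `[0, T]` of an integrable kernel vanishes at infinity. -/
lemma tendsto_integral_mul_exp_neg_nat (T : ℝ) (hT : 0 ≤ T) (K : ℝ → ℝ)
    (hK : IntervalIntegrable K volume 0 T) :
    Tendsto (fun n : ℕ => ∫ r in (0:ℝ)..T, K r * Real.exp (-(n * r))) atTop (𝓝 0) := by
  have hlim := intervalIntegral.tendsto_integral_filter_of_dominated_convergence
    (μ := volume) (a := 0) (b := T) (l := atTop) (f := fun _ : ℝ => (0:ℝ))
    (F := fun (n : ℕ) r => K r * Real.exp (-(n * r))) (fun r => ‖K r‖) ?_ ?_ hK.norm ?_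
  · simpa using hlim
  · refine Eventually.of_forall fun n => ?_
    rw [uIoc_of_le hT]
    exact hK.1.aestronglyMeasurable.mul
      (by fun_prop : Continuous fun r : ℝ => Real.exp (-(n * r))).aestronglyMeasurable
  · refine Eventually.of_forall fun n => Eventually.of_forall fun r hr => ?_
    rw [uIoc_of_le hT] at hr
    rw [norm_mul, Real.norm_eq_abs (Real.exp _), Real.abs_exp]
    refine mul_le_of_le_one_right (norm_nonneg _) (Real.exp_le_one_iff.2 ?_)
    have := mul_nonneg n.cast_nonneg hr.1.le
    linarith
  · refine Eventually.of_forall fun r hr => ?_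
    rw [uIoc_of_le hT] at hr
    have hexp : Tendsto (fun n : ℕ => Real.exp (-(n * r))) atTop (𝓝 0) :=
      Real.tendsto_exp_neg_atTop_nhds_zero.comp
        (tendsto_natCast_atTop_atTop.atTop_mul_const hr.1)
    simpa using hexp.const_mul (K r)

/-- A reflected integrable kernel times a Lipschitz function of a bounded measurable function is
integrable. -/
lemma intervalIntegrable_kernel_mul_comp {T t : ℝ} (ht : t ∈ Icc (0:ℝ) T) {K P f : ℝ → ℝ}
    (hK : IntervalIntegrable (fun s => K (t - s)) volume 0 t)
    {L : NNReal} (hP : LipschitzWith L P) (hf : Measurable f)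
    (hfbdd : ∃ M : ℝ, ∀ t ∈ Icc (0:ℝ) T, |f t| ≤ M) :
    IntervalIntegrable (fun s => K (t - s) * P (f s)) volume 0 t := by
  obtain ⟨M, hM⟩ := hfbdd
  rw [intervalIntegrable_iff_integrableOn_Ioc_of_le ht.1] at hK ⊢
  refine Integrable.mul_bdd (c := |P 0| + L * M) hK
    (hP.continuous.measurable.comp hf).aestronglyMeasurable ?_
  refine (ae_restrict_iff' measurableSet_Ioc).2 (Eventually.of_forall fun s hs => ?_)
  have hdist := hP.dist_le_mul (f s) 0
  rw [Real.dist_eq, Real.dist_eq, sub_zero] at hdist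
  have hbound : (L : ℝ) * |f s| ≤ L * M :=
    mul_le_mul_of_nonneg_left (hM s ⟨hs.1.le, hs.2.trans ht.2⟩) L.coe_nonneg
  have htri := abs_sub_abs_le_abs_sub (P (f s)) (P 0)
  rw [Real.norm_eq_abs]
  linarith

/-- For a monotone Lipschitz function, an upper bound on `x - y` bounds `P x - P y`. -/
lemma Monotone.sub_le_mul_of_lipschitzWith {P : ℝ → ℝ} (hmono : Monotone P) {L : NNReal}
    (hP : LipschitzWith L P) {x y c : ℝ} (hc : 0 ≤ c) (hxy : x - y ≤ c) :
    P x - P y ≤ L * c := by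
  rcases le_total x y with h | h
  · exact (sub_nonpos.2 (hmono h)).trans (mul_nonneg L.coe_nonneg hc)
  · have hdist := hP.dist_le_mul x y
    rw [Real.dist_eq, Real.dist_eq, abs_of_nonneg (sub_nonneg.2 h)] at hdist
    exact (le_abs_self _).trans
      (hdist.trans (mul_le_mul_of_nonneg_left hxy L.coe_nonneg))

/-- V-maximum principle: for the generalized nonlinear Volterra equation with
`K ∈ L¹([0,T])`, `K ≥ 0` a.e., and `P` nondecreasing Lipschitz, every (bounded
measurable) subsolution stays below every (bounded measurable) supersolution. -/
theorem volterra_V_maximum_principle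
    (T : ℝ) (hT : 0 < T) (K : ℝ → ℝ)
    (hKint : IntegrableOn K (Icc (0:ℝ) T))
    (hKpos : ∀ᵐ s ∂(volume.restrict (Icc (0:ℝ) T)), 0 ≤ K s)
    (a : ℝ) (ha : 0 ≤ a)
    (P : ℝ → ℝ) (hPmono : Monotone P) (L : NNReal) (hPlip : LipschitzWith L P)
    (f g : ℝ → ℝ) (hfmeas : Measurable f) (hgmeas : Measurable g)
    (hfbdd : ∃ M : ℝ, ∀ t ∈ Icc (0:ℝ) T, |f t| ≤ M)
    (hgbdd : ∃ M : ℝ, ∀ t ∈ Icc (0:ℝ) T, |g t| ≤ M)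
    (hfsub : ∀ t ∈ Icc (0:ℝ) T,
      f t ≤ a + ∫ s in (0:ℝ)..t, K (t - s) * P (f s))
    (hgsuper : ∀ t ∈ Icc (0:ℝ) T,
      a + (∫ s in (0:ℝ)..t, K (t - s) * P (g s)) ≤ g t) :
    ∀ t ∈ Icc (0:ℝ) T, f t ≤ g t := by
  have hK : IntervalIntegrable K volume 0 T :=
    (intervalIntegrable_iff_integrableOn_Icc_of_le hT.le).2 hKint
  obtain ⟨n, hn⟩ : ∃ n : ℕ, L * (∫ r in (0:ℝ)..T, K r * Real.exp (-(n * r))) < 1 / 2 := by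
    have hlim := (tendsto_integral_mul_exp_neg_nat T hT.le K hK).const_mul (L : ℝ)
    rw [mul_zero] at hlim
    exact (hlim.eventually_lt_const (by norm_num)).exists
  have contract : ∀ C : ℝ, 0 ≤ C →
      (∀ t ∈ Icc (0:ℝ) T, f t - g t ≤ C * Real.exp (n * t)) →
      ∀ t ∈ Icc (0:ℝ) T, f t - g t ≤ C / 2 * Real.exp (n * t) := by
    intro C hC hfg t ht
    have hKt : IntervalIntegrable K volume 0 t :=
      hK.mono_set (by rw [uIcc_of_le ht.1, uIcc_of_le hT.le]; exact Icc_subset_Icc_right ht.2)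
    have hKrefl : IntervalIntegrable (fun s => K (t - s)) volume 0 t := by
      simpa using (hKt.comp_sub_left t).symm
    have hKrefl_nonneg : ∀ᵐ s, s ∈ Icc (0:ℝ) t → 0 ≤ K (t - s) := by
      have h := (Measure.measurePreserving_sub_left volume t).quasiMeasurePreserving.ae
        ((ae_restrict_iff' measurableSet_Icc).1 hKpos)
      filter_upwards [h] with s hs hst
      exact hs ⟨sub_nonneg.2 hst.2, by linarith [hst.1, ht.2]⟩
    have hif := intervalIntegrable_kernel_mul_comp ht hKrefl hPlip hfmeas hfbdd
    have hig := intervalIntegrable_kernel_mul_comp ht hKrefl hPlip hgmeas hgbdd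
    have hexpint : IntervalIntegrable
        (fun s => K (t - s) * (L * (C * Real.exp (n * s)))) volume 0 t :=
      hKrefl.mul_continuousOn (by fun_prop)
    have hweight : IntervalIntegrable (fun r => K r * Real.exp (-(n * r))) volume 0 T :=
      hK.mul_continuousOn (by fun_prop)
    calc f t - g t
        ≤ (∫ s in (0:ℝ)..t, K (t - s) * P (f s)) - ∫ s in (0:ℝ)..t, K (t - s) * P (g s) := by
          linarith [hfsub t ht, hgsuper t ht]
      _ = ∫ s in (0:ℝ)..t, (K (t - s) * P (f s) - K (t - s) * P (g s)) :=
          (intervalIntegral.integral_sub hif hig).symm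
      _ ≤ ∫ s in (0:ℝ)..t, K (t - s) * (L * (C * Real.exp (n * s))) := by
          refine intervalIntegral.integral_mono_ae_restrict ht.1 (hif.sub hig) hexpint ?_
          refine (ae_restrict_iff' measurableSet_Icc).2 ?_
          filter_upwards [hKrefl_nonneg] with s hs hst
          rw [← mul_sub]
          exact mul_le_mul_of_nonneg_left
            (hPmono.sub_le_mul_of_lipschitzWith hPlip (by positivity)
              (hfg s ⟨hst.1, hst.2.trans ht.2⟩)) (hs hst)
      _ = ∫ s in (0:ℝ)..t,
            (L * C * Real.exp (n * t)) * (K (t - s) * Real.exp (-(n * (t - s)))) := by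
          refine intervalIntegral.integral_congr fun s _ => ?_
          have hexp : Real.exp (n * s) = Real.exp (n * t) * Real.exp (-(n * (t - s))) := by
            rw [← Real.exp_add]; ring_nf
          simp only [hexp]
          ring
      _ = (L * C * Real.exp (n * t)) * ∫ r in (0:ℝ)..t, K r * Real.exp (-(n * r)) := by
          rw [intervalIntegral.integral_const_mul,
            intervalIntegral.integral_comp_sub_left (fun r => K r * Real.exp (-(n * r))) t]
          simp
      _ ≤ (L * C * Real.exp (n * t)) * ∫ r in (0:ℝ)..T, K r * Real.exp (-(n * r)) := by
          refine mul_le_mul_of_nonneg_left ?_ (by positivity)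
          refine intervalIntegral.integral_mono_interval le_rfl ht.1 ht.2 ?_ hweight
          filter_upwards [ae_restrict_of_ae_restrict_of_subset Ioc_subset_Icc_self hKpos]
            with r hr
          exact mul_nonneg hr (Real.exp_pos _).le
      _ = (C * Real.exp (n * t)) * (L * ∫ r in (0:ℝ)..T, K r * Real.exp (-(n * r))) := by
          ring
      _ ≤ (C * Real.exp (n * t)) * (1 / 2) :=
          mul_le_mul_of_nonneg_left hn.le (by positivity)
      _ = C / 2 * Real.exp (n * t) := by ring
  obtain ⟨M, hM⟩ := hfbdd
  obtain ⟨N, hN⟩ := hgbdd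
  have hMN : 0 ≤ M + N := by
    have h0 : (0:ℝ) ∈ Icc (0:ℝ) T := ⟨le_rfl, hT.le⟩
    linarith [abs_nonneg (f 0), abs_nonneg (g 0), hM 0 h0, hN 0 h0]
  have iterate : ∀ k : ℕ, ∀ t ∈ Icc (0:ℝ) T,
      f t - g t ≤ (M + N) * (1 / 2) ^ k * Real.exp (n * t) := by
    intro k
    induction k with
    | zero =>
      intro t ht
      have hexp : 1 ≤ Real.exp (n * t) := Real.one_le_exp (mul_nonneg n.cast_nonneg ht.1)
      have hle := le_mul_of_one_le_right hMN hexp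
      rw [pow_zero, mul_one]
      linarith [(abs_le.1 (hM t ht)).2, (abs_le.1 (hN t ht)).1]
    | succ k ih =>
      intro t ht
      refine (contract _ (by positivity) ih t ht).trans_eq ?_
      rw [pow_succ]
      ring
  intro t ht
  have hlim : Tendsto (fun k : ℕ => (M + N) * (1 / 2 : ℝ) ^ k * Real.exp (n * t))
      atTop (𝓝 0) := by
    simpa using ((tendsto_pow_atTop_nhds_zero_of_lt_one (r := (1 / 2 : ℝ))
      (by norm_num) (by norm_num)).const_mul (M + N)).mul_const (Real.exp (n * t))
  exact sub_nonpos.1 (ge_of_tendsto' hlim fun k => iterate k t ht)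
end

section
/- Let K : [0,∞) → ℝ be locally integrable with K ≥ 0 almost everywhere, let a ≥ 0, and let α₁, α₂ ≥ 0. Then there exists a unique continuous function f : [0,∞) → ℝ satisfying the linear Volterra equation f(t) = a + ∫₀ᵗ K(t−s)(α₁ + α₂ f(s)) ds for all t ≥ 0; in particular the solution of the linear Volterra equation is defined globally in time. -/
open MeasureTheory Set

open Filter Topology BoundedContinuousFunction

/-- The causal convolution of an integrable kernel with a bounded continuous function is
continuous. -/
lemma continuous_integral_Iic_mul_comp_sub {k : ℝ → ℝ} (hk : Integrable k) (v : ℝ →ᵇ ℝ) :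
    Continuous fun t : ℝ => ∫ x in Iic t, k x * v (t - x) := by
  simp_rw [← integral_indicator measurableSet_Iic]
  rw [continuous_iff_continuousAt]
  intro t₀
  refine continuousAt_of_dominated (bound := fun x => ‖k x‖ * ‖v‖) ?_ ?_
    (hk.norm.mul_const _) ?_
  · refine Eventually.of_forall fun t => ?_
    exact (hk.aestronglyMeasurable.mul
      (by fun_prop : Continuous fun x => v (t - x)).aestronglyMeasurable).indicator
        measurableSet_Iic
  · refine Eventually.of_forall fun t => Eventually.of_forall fun x => ?_
    refine (norm_indicator_le_norm_self _ _).trans ?_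
    rw [norm_mul]
    gcongr
    exact v.norm_coe_le_norm _
  · have hne : ∀ᵐ x : ℝ, x ≠ t₀ := by simp [ae_iff]
    filter_upwards [hne] with x hx
    have hc : ContinuousAt (fun t => k x * v (t - x)) t₀ := by fun_prop
    rcases lt_or_gt_of_ne hx with h | h
    · refine hc.congr ?_
      filter_upwards [lt_mem_nhds h] with t ht
      rw [indicator_of_mem (mem_Iic.2 ht.le)]
    · refine (continuousAt_const (y := (0 : ℝ))).congr ?_
      filter_upwards [gt_mem_nhds h] with t ht
      rw [indicator_of_notMem (by simpa using ht)]

lemma norm_integral_Iic_mul_comp_sub_le {k : ℝ → ℝ} (hk : Integrable k) (v : ℝ →ᵇ ℝ) (t : ℝ) :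
    ‖∫ x in Iic t, k x * v (t - x)‖ ≤ (∫ x, ‖k x‖) * ‖v‖ := by
  calc ‖∫ x in Iic t, k x * v (t - x)‖
      ≤ ∫ x in Iic t, ‖k x‖ * ‖v‖ := by
        refine norm_integral_le_of_norm_le (hk.norm.mul_const _).integrableOn
          (Eventually.of_forall fun x => ?_)
        rw [norm_mul]
        gcongr
        exact v.norm_coe_le_norm _
    _ ≤ ∫ x, ‖k x‖ * ‖v‖ :=
        setIntegral_le_integral (hk.norm.mul_const _)
          (Eventually.of_forall fun x => by positivity)
    _ = _ := integral_mul_const _ _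

/-- A convolution equation of the second kind with kernel of `L¹` norm less than one is solvable
in the bounded continuous functions. -/
lemma exists_eq_add_integral_Iic_of_integral_norm_lt_one {k : ℝ → ℝ} (hk : Integrable k)
    (hk1 : ∫ x, ‖k x‖ < 1) (G : ℝ →ᵇ ℝ) :
    ∃ h : ℝ →ᵇ ℝ, ∀ t, h t = G t + ∫ x in Iic t, k x * h (t - x) := by
  let A : (ℝ →ᵇ ℝ) → (ℝ →ᵇ ℝ) := fun v =>
    BoundedContinuousFunction.ofNormedAddCommGroup (fun t => ∫ x in Iic t, k x * v (t - x))
      (continuous_integral_Iic_mul_comp_sub hk v) _ (norm_integral_Iic_mul_comp_sub_le hk v)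
  have hint (v : ℝ →ᵇ ℝ) (t : ℝ) : Integrable fun x => k x * v (t - x) := by
    refine hk.mul_bdd (c := ‖v‖) ?_ (Eventually.of_forall fun x => v.norm_coe_le_norm _)
    exact (by fun_prop : Continuous fun x => v (t - x)).aestronglyMeasurable
  have hq : 0 ≤ ∫ x, ‖k x‖ := by positivity
  have hA : ContractingWith ⟨∫ x, ‖k x‖, hq⟩ fun v => G + A v := by
    refine ⟨by exact_mod_cast hk1, LipschitzWith.of_dist_le_mul fun u v => ?_⟩
    rw [dist_add_left, dist_eq_norm u v]
    refine (BoundedContinuousFunction.dist_le (by positivity)).2 fun t => ?_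
    have hsub : A u t - A v t = ∫ x in Iic t, k x * (u - v) (t - x) := by
      simp only [A, BoundedContinuousFunction.coe_ofNormedAddCommGroup,
        BoundedContinuousFunction.coe_sub, Pi.sub_apply, mul_sub]
      rw [integral_sub (hint u t).integrableOn (hint v t).integrableOn]
    rw [dist_eq_norm, hsub]
    exact norm_integral_Iic_mul_comp_sub_le hk (u - v) t
  obtain ⟨h, hh⟩ : ∃ h, G + A h = h := ⟨_, hA.fixedPoint_isFixedPt⟩
  refine ⟨h, fun t => ?_⟩
  conv_lhs => rw [← hh]
  rfl

/-- An exponential weight makes the `L¹` norm of a kernel on a bounded interval small. -/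
lemma exists_mul_integral_exp_mul_norm_lt_one {K : ℝ → ℝ} {T : ℝ} (hK : IntegrableOn K (Ioc 0 T))
    (α : ℝ) : ∃ r : ℝ, α * ∫ x in Ioc 0 T, Real.exp (-(r * x)) * ‖K x‖ < 1 := by
  have hlim : Tendsto (fun n : ℕ => ∫ x in Ioc 0 T, Real.exp (-(n * x)) * ‖K x‖) atTop
      (𝓝 (∫ x in Ioc 0 T, (0 : ℝ))) := by
    refine tendsto_integral_of_dominated_convergence (fun x => ‖K x‖) (fun n => ?_) hK.norm
      (fun n => ?_) ?_
    · exact (by fun_prop : Continuous fun x : ℝ => Real.exp (-(n * x))).aestronglyMeasurable.mul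
        hK.norm.aestronglyMeasurable
    · filter_upwards [ae_restrict_mem measurableSet_Ioc] with x hx
      rw [norm_mul, norm_norm, Real.norm_of_nonneg (Real.exp_pos _).le]
      refine mul_le_of_le_one_left (norm_nonneg _) (Real.exp_le_one_iff.2 ?_)
      have := hx.1.le
      simp only [Left.neg_nonpos_iff]
      positivity
    · filter_upwards [ae_restrict_mem measurableSet_Ioc] with x hx
      rw [← zero_mul ‖K x‖]
      refine Tendsto.mul_const _ (Real.tendsto_exp_neg_atTop_nhds_zero.comp ?_)
      exact tendsto_natCast_atTop_atTop.atTop_mul_const hx.1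
  have := hlim.const_mul α
  rw [integral_zero, mul_zero] at this
  obtain ⟨n, hn⟩ := (this.eventually_lt_const one_pos).exists
  exact ⟨n, hn⟩

/-- Solvability of the linear Volterra equation on a bounded interval. -/
lemma exists_linear_volterra_solution_on_Icc {K : ℝ → ℝ} {T : ℝ} (hT : 0 ≤ T)
    (hK : IntegrableOn K (Ioc 0 T)) (a α₁ : ℝ) {α₂ : ℝ} (hα₂ : 0 ≤ α₂) :
    ∃ f : ℝ → ℝ, Continuous f ∧ ∀ t ∈ Icc 0 T,
      f t = a + ∫ s in (0 : ℝ)..t, K (t - s) * (α₁ + α₂ * f s) := by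
  obtain ⟨r, hr⟩ := exists_mul_integral_exp_mul_norm_lt_one hK α₂
  have hexp : Integrable ((Ioc 0 T).indicator fun x => α₂ * (Real.exp (-(r * x)) * K x)) := by
    rw [integrable_indicator_iff measurableSet_Ioc]
    refine Integrable.const_mul ?_ _
    refine ((IntegrableOn.continuousOn_mul (K := Icc 0 T) (by fun_prop) ?_
      isCompact_Icc).mono_set Ioc_subset_Icc_self)
    rwa [integrableOn_Icc_iff_integrableOn_Ioc]
  have hnorm : ∫ x, ‖(Ioc 0 T).indicator (fun x => α₂ * (Real.exp (-(r * x)) * K x)) x‖ < 1 := by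
    simp_rw [norm_indicator_eq_indicator_norm]
    rw [integral_indicator measurableSet_Ioc]
    simpa [norm_mul, abs_of_nonneg hα₂, integral_const_mul] using hr
  have hGc : Continuous fun t =>
      Real.exp (-(r * t)) * (a + α₁ * ∫ x in (0 : ℝ)..t, (Ioc 0 T).indicator K x) := by
    have : Continuous fun t => ∫ x in (0 : ℝ)..t, (Ioc 0 T).indicator K x :=
      intervalIntegral.continuous_primitive
        (fun _ _ => ((integrable_indicator_iff measurableSet_Ioc).2 hK).intervalIntegrable) 0
    fun_prop
  let G : ℝ →ᵇ ℝ := (BoundedContinuousFunction.mkOfCompact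
    (⟨_, hGc.comp continuous_subtype_val⟩ : C(Icc 0 T, ℝ))).compContinuous
      ⟨projIcc 0 T hT, continuous_projIcc⟩
  obtain ⟨h, hh⟩ := exists_eq_add_integral_Iic_of_integral_norm_lt_one hexp hnorm G
  refine ⟨fun t => Real.exp (r * t) * h t, by fun_prop, fun t ht => ?_⟩
  have hGt : G t = Real.exp (-(r * t)) * (a + α₁ * ∫ x in (0 : ℝ)..t, K x) := by
    have h1 : G t = Real.exp (-(r * t)) *
        (a + α₁ * ∫ x in (0 : ℝ)..t, (Ioc 0 T).indicator K x) := by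
      simp [G, projIcc_of_mem hT ht]
    rw [h1, intervalIntegral.integral_of_le ht.1, intervalIntegral.integral_of_le ht.1,
      setIntegral_indicator measurableSet_Ioc,
      inter_eq_left.2 (Ioc_subset_Ioc_right ht.2)]
  have hset : Iic t ∩ Ioc 0 T = Ioc 0 t := by
    ext x
    simp only [mem_inter_iff, mem_Iic, mem_Ioc]
    have := ht.2
    grind
  have hKt : IntervalIntegrable K volume 0 t := by
    rw [intervalIntegrable_iff_integrableOn_Ioc_of_le ht.1]
    exact hK.mono_set (Ioc_subset_Ioc_right ht.2)
  have hsub := intervalIntegral.integral_comp_sub_left (a := 0) (b := t)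
    (fun x => K x * (α₁ + α₂ * (Real.exp (r * (t - x)) * h (t - x)))) t
  simp only [sub_sub_cancel, sub_self, sub_zero] at hsub
  have hsplit : ∫ x in (0 : ℝ)..t, K x * (α₁ + α₂ * (Real.exp (r * (t - x)) * h (t - x))) =
      α₁ * (∫ x in (0 : ℝ)..t, K x) +
        ∫ x in (0 : ℝ)..t, K x * (α₂ * (Real.exp (r * (t - x)) * h (t - x))) := by
    simp_rw [mul_add]
    rw [intervalIntegral.integral_add (hKt.mul_const _)
      (hKt.mul_continuousOn (by fun_prop)), intervalIntegral.integral_mul_const, mul_comm]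
  have hconv : Real.exp (r * t) * ∫ x in Iic t,
        (Ioc 0 T).indicator (fun x => α₂ * (Real.exp (-(r * x)) * K x)) x * h (t - x) =
      ∫ x in (0 : ℝ)..t, K x * (α₂ * (Real.exp (r * (t - x)) * h (t - x))) := by
    simp_rw [← indicator_mul_left (Ioc 0 T) _ fun x => h (t - x)]
    rw [setIntegral_indicator measurableSet_Ioc, hset, intervalIntegral.integral_of_le ht.1,
      ← integral_const_mul]
    congr 1 with x
    rw [mul_sub, sub_eq_add_neg (r * t), Real.exp_add]
    ring
  beta_reduce
  rw [hsub, hsplit, ← hconv, hh t, hGt, mul_add, ← mul_assoc, ← Real.exp_add]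
  simp [add_assoc]

/-- Uniqueness for the linear Volterra equation on a bounded interval. -/
lemma linear_volterra_solution_unique_on_Icc {K : ℝ → ℝ} {T : ℝ}
    (hK : IntegrableOn K (Ioc 0 T)) {a α₁ α₂ : ℝ} (hα₂ : 0 ≤ α₂) {f g : ℝ → ℝ}
    (hfc : ContinuousOn f (Icc 0 T)) (hgc : ContinuousOn g (Icc 0 T))
    (hf : ∀ t ∈ Icc 0 T, f t = a + ∫ s in (0 : ℝ)..t, K (t - s) * (α₁ + α₂ * f s))
    (hg : ∀ t ∈ Icc 0 T, g t = a + ∫ s in (0 : ℝ)..t, K (t - s) * (α₁ + α₂ * g s)) :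
    EqOn f g (Icc 0 T) := by
  obtain ⟨r, hr⟩ := exists_mul_integral_exp_mul_norm_lt_one hK α₂
  rcases (Icc 0 T).eq_empty_or_nonempty with hT | hT
  · simp [hT]
  obtain ⟨t, ht, hmax⟩ := isCompact_Icc.exists_isMaxOn (α := ℝ)
    (f := fun t => Real.exp (-(r * t)) * ‖f t - g t‖) hT (by fun_prop)
  set M := Real.exp (-(r * t)) * ‖f t - g t‖ with hM
  have hKt : IntegrableOn K (Ioc 0 t) := hK.mono_set (Ioc_subset_Ioc_right ht.2)
  have hKr : IntervalIntegrable (fun s => K (t - s)) volume 0 t := by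
    have := ((intervalIntegrable_iff_integrableOn_Ioc_of_le ht.1).2 hKt).comp_sub_left t
    simpa using this.symm
  have hsubset : uIcc 0 t ⊆ Icc 0 T := by
    rw [uIcc_of_le ht.1]
    exact Icc_subset_Icc_right ht.2
  have hfc' := hfc.mono hsubset
  have hgc' := hgc.mono hsubset
  have hdiff : f t - g t = ∫ s in (0 : ℝ)..t, K (t - s) * (α₂ * (f s - g s)) := by
    rw [hf t ht, hg t ht, add_sub_add_left_eq_sub, ← intervalIntegral.integral_sub
      (hKr.mul_continuousOn (by fun_prop)) (hKr.mul_continuousOn (by fun_prop))]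
    congr 1 with s
    ring
  have hwK : IntegrableOn (fun x => Real.exp (-(r * x)) * ‖K x‖) (Ioc 0 T) := by
    refine ((IntegrableOn.continuousOn_mul (K := Icc 0 T) (by fun_prop) ?_
      isCompact_Icc).mono_set Ioc_subset_Icc_self)
    rw [integrableOn_Icc_iff_integrableOn_Ioc]
    exact hK.norm
  have hM0 : 0 ≤ M := by positivity
  have hle : M ≤ (α₂ * ∫ x in Ioc 0 T, Real.exp (-(r * x)) * ‖K x‖) * M := by
    have hsub := intervalIntegral.integral_comp_sub_left (a := 0) (b := t)
      (fun x => Real.exp (-(r * x)) * ‖K x‖) t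
    simp only [sub_self, sub_zero] at hsub
    have hwr : IntervalIntegrable (fun s => Real.exp (-(r * (t - s))) * ‖K (t - s)‖)
        volume 0 t := hKr.norm.continuousOn_mul (by fun_prop)
    calc M = ‖∫ s in (0 : ℝ)..t, Real.exp (-(r * t)) * (K (t - s) * (α₂ * (f s - g s)))‖ := by
          rw [intervalIntegral.integral_const_mul, ← hdiff, norm_mul,
            Real.norm_of_nonneg (Real.exp_pos _).le]
      _ ≤ ∫ s in (0 : ℝ)..t, Real.exp (-(r * (t - s))) * ‖K (t - s)‖ * (α₂ * M) := by
          refine intervalIntegral.norm_integral_le_of_norm_le ht.1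
            (Eventually.of_forall fun s hs => ?_) (hwr.mul_const _)
          have hsM : Real.exp (-(r * s)) * ‖f s - g s‖ ≤ M :=
            hmax ⟨hs.1.le, hs.2.trans ht.2⟩
          have he : Real.exp (-(r * t)) = Real.exp (-(r * (t - s))) * Real.exp (-(r * s)) := by
            rw [← Real.exp_add]
            ring_nf
          rw [norm_mul, norm_mul, norm_mul, Real.norm_of_nonneg (Real.exp_pos _).le,
            Real.norm_of_nonneg hα₂, he]
          calc _ = Real.exp (-(r * (t - s))) * ‖K (t - s)‖ *
                (α₂ * (Real.exp (-(r * s)) * ‖f s - g s‖)) := by ring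
            _ ≤ _ := by gcongr
      _ = (α₂ * ∫ x in Ioc 0 t, Real.exp (-(r * x)) * ‖K x‖) * M := by
          rw [intervalIntegral.integral_mul_const, hsub, intervalIntegral.integral_of_le ht.1]
          ring
      _ ≤ _ := by
          gcongr
          · exact Eventually.of_forall fun x => by positivity
          · exact ht.2
  have hMz : M = 0 := by nlinarith
  intro s hs
  have hs' : Real.exp (-(r * s)) * ‖f s - g s‖ ≤ 0 := hMz ▸ hmax hs
  have hz : ‖f s - g s‖ ≤ 0 := nonpos_of_mul_nonpos_right hs' (Real.exp_pos _)
  exact sub_eq_zero.1 (norm_le_zero_iff.1 hz)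

/-- Global existence and uniqueness for the linear Volterra equation
`f(t) = a + ∫₀ᵗ K(t−s)(α₁ + α₂ f(s)) ds` with a locally integrable nonnegative
kernel on `[0,∞)`. -/
theorem linear_volterra_global_existence_uniqueness
    (K : ℝ → ℝ)
    (hKint : LocallyIntegrableOn K (Ici (0:ℝ)))
    (hKpos : ∀ᵐ s ∂(volume.restrict (Ici (0:ℝ))), 0 ≤ K s)
    (a : ℝ) (ha : 0 ≤ a)
    (α₁ α₂ : ℝ) (hα₁ : 0 ≤ α₁) (hα₂ : 0 ≤ α₂) :
    ∃ f : ℝ → ℝ,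
      (ContinuousOn f (Ici (0:ℝ)) ∧
        ∀ t : ℝ, 0 ≤ t →
          f t = a + ∫ s in (0:ℝ)..t, K (t - s) * (α₁ + α₂ * f s)) ∧
      ∀ g : ℝ → ℝ,
        (ContinuousOn g (Ici (0:ℝ)) ∧
          ∀ t : ℝ, 0 ≤ t →
            g t = a + ∫ s in (0:ℝ)..t, K (t - s) * (α₁ + α₂ * g s)) →
        ∀ t : ℝ, 0 ≤ t → g t = f t := by
  have hK (T : ℝ) : IntegrableOn K (Ioc 0 T) :=
    (hKint.integrableOn_compact_subset Icc_subset_Ici_self isCompact_Icc).mono_set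
      Ioc_subset_Icc_self
  choose! u huc hu using fun (T : ℝ) (hT : 0 ≤ T) =>
    exists_linear_volterra_solution_on_Icc hT (hK T) a α₁ hα₂
  have hglue (T : ℝ) : EqOn (fun t => u t t) (u T) (Icc 0 T) := fun t ht =>
    linear_volterra_solution_unique_on_Icc (hK t) hα₂ (huc t ht.1).continuousOn
      (huc T (ht.1.trans ht.2)).continuousOn (hu t ht.1)
      (fun s hs => hu T (ht.1.trans ht.2) s (Icc_subset_Icc_right ht.2 hs))
      (right_mem_Icc.2 ht.1)
  refine ⟨fun t => u t t, ⟨fun t ht => ?_, fun t ht => ?_⟩, fun g hg t ht => ?_⟩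
  · have ht' : 0 ≤ t := ht
    refine (huc (t + 1) (by positivity)).continuousWithinAt.congr_of_eventuallyEq ?_
      (hglue (t + 1) ⟨ht, by linarith⟩)
    filter_upwards [self_mem_nhdsWithin,
      mem_nhdsWithin_of_mem_nhds (gt_mem_nhds (lt_add_one t))] with s hs hst
    exact hglue (t + 1) ⟨hs, le_of_lt hst⟩
  · refine (hu t ht t (right_mem_Icc.2 ht)).trans ?_
    congr 1
    refine intervalIntegral.integral_congr fun s hs => ?_
    rw [uIcc_of_le ht] at hs
    have := hglue t hs
    simp only at this
    simp only [this]
  · exact linear_volterra_solution_unique_on_Icc (hK t) hα₂ (hg.1.mono Icc_subset_Ici_self)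
      (huc t ht).continuousOn (fun s hs => hg.2 s hs.1) (hu t ht) (right_mem_Icc.2 ht)
end

section
/- Let ν > 0 and define G(t,x) = (1/|x|) ∫₀^{|x|} e^{−ρ²/(4νt)}/√t dρ for t > 0 and x ∈ ℝ³ \ {0}. Then for all i, j ∈ {1,2,3}, t > 0 and x ≠ 0, the second partial derivative of G satisfies ∂²G/∂xᵢ∂xⱼ(t,x) = − δ_{ij} e^{−|x|²/(4νt)} / (6ν t^{3/2}) + ( xᵢ xⱼ / (4ν² t^{5/2} |x|⁵) − δ_{ij} / (12ν² t^{5/2} |x|³) ) ∫₀^{|x|} ρ⁴ e^{−ρ²/(4νt)} dρ, where δ_{ij} is the Kronecker delta. -/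
open MeasureTheory

/-- The Oseen potential function `G(t,x) = (1/|x|) ∫₀^{|x|} e^{−ρ²/(4νt)}/√t dρ`. -/
noncomputable def oseenG (ν : ℝ) (t : ℝ) (x : EuclideanSpace ℝ (Fin 3)) : ℝ :=
  (1 / ‖x‖) * ∫ ρ in (0:ℝ)..‖x‖, Real.exp (-ρ ^ 2 / (4 * ν * t)) / Real.sqrt t

/-- The derivative of a radial function away from the origin. -/
theorem HasDerivAt.hasFDerivAt_comp_norm {E : Type*} [NormedAddCommGroup E]
    [InnerProductSpace ℝ E] {φ : ℝ → ℝ} {φ' : ℝ} {x : E} (hx : x ≠ 0)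
    (hφ : HasDerivAt φ φ' ‖x‖) :
    HasFDerivAt (fun y : E => φ ‖y‖) ((φ' / ‖x‖) • innerSL ℝ x) x := by
  have hr : ‖x‖ ≠ 0 := norm_ne_zero_iff.mpr hx
  have hsq := (hasStrictFDerivAt_norm_sq x).hasFDerivAt.sqrt (pow_ne_zero 2 hr)
  simp only [Real.sqrt_sq (norm_nonneg _)] at hsq
  refine (hφ.comp_hasFDerivAt x hsq).congr_fderiv ?_
  ext v
  simp only [smul_apply, nsmul_eq_mul, smul_eq_mul, innerSL_apply_apply]
  field_simp
  norm_num

theorem hasDerivAt_exp_neg_sq_div (a r : ℝ) :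
    HasDerivAt (fun ρ : ℝ => Real.exp (-ρ ^ 2 / a)) (-(2 * r / a) * Real.exp (-r ^ 2 / a)) r := by
  refine (((hasDerivAt_pow 2 r).neg.div_const a).exp).congr_deriv ?_
  simp only [Pi.neg_apply]
  push_cast
  ring

theorem continuous_exp_neg_sq_div (a : ℝ) : Continuous fun ρ : ℝ => Real.exp (-ρ ^ 2 / a) := by
  fun_prop

theorem hasDerivAt_integral_exp_neg_sq_div (a r : ℝ) :
    HasDerivAt (fun s : ℝ => ∫ ρ in (0:ℝ)..s, Real.exp (-ρ ^ 2 / a)) (Real.exp (-r ^ 2 / a)) r :=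
  ((continuous_exp_neg_sq_div a).integral_hasStrictDerivAt 0 r).hasDerivAt

/-- Reduction of the fourth Gaussian moment on `[0, r]` to the zeroth one. -/
theorem integral_pow_four_mul_exp_neg_sq_div {a : ℝ} (ha : a ≠ 0) (r : ℝ) :
    ∫ ρ in (0:ℝ)..r, ρ ^ 4 * Real.exp (-ρ ^ 2 / a) =
      3 * a ^ 2 / 4 * (∫ ρ in (0:ℝ)..r, Real.exp (-ρ ^ 2 / a)) -
        (a / 2 * r ^ 3 + 3 * a ^ 2 / 4 * r) * Real.exp (-r ^ 2 / a) := by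
  have hderiv : ∀ ρ : ℝ, HasDerivAt
      (fun s : ℝ => 3 * a ^ 2 / 4 * (∫ ρ in (0:ℝ)..s, Real.exp (-ρ ^ 2 / a)) -
        (a / 2 * s ^ 3 + 3 * a ^ 2 / 4 * s) * Real.exp (-s ^ 2 / a))
      (ρ ^ 4 * Real.exp (-ρ ^ 2 / a)) ρ := by
    intro ρ
    refine (((hasDerivAt_integral_exp_neg_sq_div a ρ).const_mul (3 * a ^ 2 / 4)).sub
      ((((hasDerivAt_pow 3 ρ).const_mul (a / 2)).add
        ((hasDerivAt_id ρ).const_mul (3 * a ^ 2 / 4))).mul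
          (hasDerivAt_exp_neg_sq_div a ρ))).congr_deriv ?_
    simp only [Pi.add_apply, id]
    field_simp
    push_cast
    ring
  rw [intervalIntegral.integral_eq_sub_of_hasDerivAt (fun ρ _ => hderiv ρ)
    (Continuous.intervalIntegrable (by fun_prop) 0 r)]
  simp

theorem oseenG_eq (ν t : ℝ) (x : EuclideanSpace ℝ (Fin 3)) :
    oseenG ν t x =
      (∫ ρ in (0:ℝ)..‖x‖, Real.exp (-ρ ^ 2 / (4 * ν * t))) / ‖x‖ / Real.sqrt t := by
  rw [oseenG, intervalIntegral.integral_div]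
  ring

/-- The first partial derivatives of the Oseen potential are `x j` times a radial function. -/
theorem fderiv_oseenG_single (ν t : ℝ) {x : EuclideanSpace ℝ (Fin 3)} (hx : x ≠ 0) (j : Fin 3) :
    fderiv ℝ (oseenG ν t) x (EuclideanSpace.single j 1) =
      (Real.exp (-‖x‖ ^ 2 / (4 * ν * t)) / ‖x‖ ^ 2 -
        (∫ ρ in (0:ℝ)..‖x‖, Real.exp (-ρ ^ 2 / (4 * ν * t))) / ‖x‖ ^ 3) / Real.sqrt t * x j := by
  have hr : ‖x‖ ≠ 0 := norm_ne_zero_iff.mpr hx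
  have hφ := ((hasDerivAt_integral_exp_neg_sq_div (4 * ν * t) ‖x‖).div
    (hasDerivAt_id ‖x‖) hr).div_const (Real.sqrt t)
  have hG := hφ.hasFDerivAt_comp_norm hx
  rw [funext (oseenG_eq ν t)]
  refine (congrArg (· (EuclideanSpace.single j 1)) hG.fderiv).trans ?_
  simp only [smul_apply, smul_eq_mul, innerSL_apply_apply,
    EuclideanSpace.inner_single_right, id,
    conj_trivial, one_mul, mul_one]
  field_simp

/-- Formula for the second partial derivatives of the Oseen potential:
`∂²G/∂xᵢ∂xⱼ(t,x) = −δᵢⱼ e^{−|x|²/(4νt)}/(6νt^{3/2})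
  + (xᵢxⱼ/(4ν²t^{5/2}|x|⁵) − δᵢⱼ/(12ν²t^{5/2}|x|³)) ∫₀^{|x|} ρ⁴ e^{−ρ²/(4νt)} dρ`. -/
theorem oseenG_second_fderiv_eq (ν : ℝ) (hν : 0 < ν) (i j : Fin 3) (t : ℝ) (ht : 0 < t)
    (x : EuclideanSpace ℝ (Fin 3)) (hx : x ≠ 0) :
    DifferentiableAt ℝ
      (fun y => fderiv ℝ (oseenG ν t) y (EuclideanSpace.single j 1)) x ∧
    fderiv ℝ (fun y => fderiv ℝ (oseenG ν t) y (EuclideanSpace.single j 1)) x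
        (EuclideanSpace.single i 1) =
      -(if i = j then (1:ℝ) else 0) * Real.exp (-‖x‖ ^ 2 / (4 * ν * t)) /
          (6 * ν * t ^ ((3:ℝ)/2)) +
        (x i * x j / (4 * ν ^ 2 * t ^ ((5:ℝ)/2) * ‖x‖ ^ 5) -
            (if i = j then (1:ℝ) else 0) / (12 * ν ^ 2 * t ^ ((5:ℝ)/2) * ‖x‖ ^ 3)) *
          ∫ ρ in (0:ℝ)..‖x‖, ρ ^ 4 * Real.exp (-ρ ^ 2 / (4 * ν * t)) := by
  have hr : ‖x‖ ≠ 0 := norm_ne_zero_iff.mpr hx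
  have hs : 0 < Real.sqrt t := Real.sqrt_pos.mpr ht
  have ha : 4 * ν * t ≠ 0 := by positivity
  have hφ := (((hasDerivAt_exp_neg_sq_div (4 * ν * t) ‖x‖).div (hasDerivAt_pow 2 ‖x‖)
    (pow_ne_zero 2 hr)).sub ((hasDerivAt_integral_exp_neg_sq_div (4 * ν * t) ‖x‖).div
      (hasDerivAt_pow 3 ‖x‖) (pow_ne_zero 3 hr))).div_const (Real.sqrt t)
  have hD := (hφ.hasFDerivAt_comp_norm hx).mul
    (EuclideanSpace.proj j : EuclideanSpace ℝ (Fin 3) →L[ℝ] ℝ).hasFDerivAt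
  have hD' := hD.congr_of_eventuallyEq
    (f₁ := fun y => fderiv ℝ (oseenG ν t) y (EuclideanSpace.single j 1)) (by
      filter_upwards [isOpen_ne.mem_nhds hx] with y hy
      exact fderiv_oseenG_single ν t hy j)
  refine ⟨hD'.differentiableAt, ?_⟩
  have h3 : t ^ ((3:ℝ)/2) = Real.sqrt t ^ 3 := by
    rw [Real.sqrt_eq_rpow, ← Real.rpow_mul_natCast ht.le]; norm_num
  have h5 : t ^ ((5:ℝ)/2) = Real.sqrt t ^ 5 := by
    rw [Real.sqrt_eq_rpow, ← Real.rpow_mul_natCast ht.le]; norm_num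
  have hδ : (EuclideanSpace.single i (1:ℝ) : EuclideanSpace ℝ (Fin 3)) j =
      if i = j then 1 else 0 := by
    simp [eq_comm]
  rw [hD'.fderiv, integral_pow_four_mul_exp_neg_sq_div ha, h3, h5]
  simp only [add_apply, smul_apply, smul_eq_mul, innerSL_apply_apply,
    EuclideanSpace.inner_single_right, PiLp.proj_apply, hδ, Pi.sub_apply, Pi.div_apply,
    conj_trivial, one_mul]
  generalize (if i = j then (1:ℝ) else 0) = δ
  generalize (∫ ρ in (0:ℝ)..‖x‖, Real.exp (-ρ ^ 2 / (4 * ν * t))) = F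
  generalize Real.exp (-‖x‖ ^ 2 / (4 * ν * t)) = E
  obtain ⟨s, hst⟩ : ∃ s, s = Real.sqrt t := ⟨_, rfl⟩
  have ht2 : t = s ^ 2 := by rw [hst, Real.sq_sqrt ht.le]
  rw [← hst] at hs ⊢
  rw [ht2]
  push_cast
  field_simp
  ring
end

section
/- Let ν > 0 and define G(t,x) = (1/|x|) ∫₀^{|x|} e^{−ρ²/(4νt)}/√t dρ for t > 0 and x ∈ ℝ³ \ {0}. Then for every m ∈ ℕ and every multi-index α ∈ ℕ³ with |α| = m, there exists a constant C_m > 0, depending only on ν and m, such that for all i, j ∈ {1,2,3}, all t > 0 and all x ≠ 0, |∂^α_x ∂²G/∂xᵢ∂xⱼ(t,x)| ≤ C_m / (|x|² + νt)^{(m+3)/2}. -/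
open MeasureTheory

/-- Partial derivative `∂/∂xᵢ` of a scalar function on `ℝ³`. -/
noncomputable def pd3 (i : Fin 3) (f : EuclideanSpace ℝ (Fin 3) → ℝ) :
    EuclideanSpace ℝ (Fin 3) → ℝ :=
  fun x => fderiv ℝ f x (EuclideanSpace.single i 1)

/-- The multi-index partial derivative `∂^α = ∂₁^{α₁} ∂₂^{α₂} ∂₃^{α₃}`. -/
noncomputable def mpd3 (α : Fin 3 → ℕ) (f : EuclideanSpace ℝ (Fin 3) → ℝ) :
    EuclideanSpace ℝ (Fin 3) → ℝ :=
  (pd3 0)^[α 0] ((pd3 1)^[α 1] ((pd3 2)^[α 2] f))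

/-- The Gaussian moment `∫₀¹ s^{2k} e^{-s²u} ds`. -/
noncomputable def gaussMoment (k : ℕ) (u : ℝ) : ℝ :=
  ∫ s in (0:ℝ)..1, s ^ (2 * k) * Real.exp (-s ^ 2 * u)

lemma hasDerivAt_gaussMoment (k : ℕ) (u : ℝ) :
    HasDerivAt (gaussMoment k) (-gaussMoment (k + 1) u) u := by
  have key := intervalIntegral.hasDerivAt_integral_of_dominated_loc_of_deriv_le
    (μ := volume) (a := (0:ℝ)) (b := 1) (x₀ := u) (s := Metric.ball u 1)
    (F := fun v s => s ^ (2 * k) * Real.exp (-s ^ 2 * v))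
    (F' := fun v s => -(s ^ (2 * (k + 1)) * Real.exp (-s ^ 2 * v)))
    (bound := fun _ => Real.exp (|u| + 1))
    (Metric.ball_mem_nhds u one_pos)
    (Filter.Eventually.of_forall fun v =>
      (by fun_prop : Continuous fun s : ℝ =>
        s ^ (2 * k) * Real.exp (-s ^ 2 * v)).aestronglyMeasurable)
    ((by fun_prop : Continuous fun s : ℝ =>
        s ^ (2 * k) * Real.exp (-s ^ 2 * u)).intervalIntegrable 0 1)
    ((by fun_prop : Continuous fun s : ℝ =>
        -(s ^ (2 * (k + 1)) * Real.exp (-s ^ 2 * u))).aestronglyMeasurable)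
    (Filter.Eventually.of_forall fun s hs v hv => ?_)
    (continuous_const.intervalIntegrable 0 1)
    (Filter.Eventually.of_forall fun s _ v _ => ?_)
  · have h := key.2
    rw [intervalIntegral.integral_neg] at h
    exact h
  · rw [Set.uIoc_of_le zero_le_one] at hs
    have hv' : |v| ≤ |u| + 1 := by
      rw [Metric.mem_ball, Real.dist_eq] at hv
      have := abs_sub_abs_le_abs_sub v u
      linarith
    have hs2 : s ^ 2 ≤ 1 := pow_le_one₀ hs.1.le hs.2
    have hexp : -s ^ 2 * v ≤ |u| + 1 := by
      have h1 : -s ^ 2 * v ≤ s ^ 2 * |v| := by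
        nlinarith [neg_abs_le v, sq_nonneg s]
      nlinarith [abs_nonneg v]
    rw [norm_neg, Real.norm_of_nonneg (by have := hs.1; positivity)]
    calc s ^ (2 * (k + 1)) * Real.exp (-s ^ 2 * v)
        ≤ 1 * Real.exp (|u| + 1) := by
          gcongr
          exact pow_le_one₀ hs.1.le hs.2
      _ = _ := one_mul _
  · have h := (((hasDerivAt_id v).const_mul (-s ^ 2)).exp).const_mul (s ^ (2 * k))
    refine h.congr_deriv ?_
    simp only [id]
    ring

lemma gaussMoment_nonneg (k : ℕ) (u : ℝ) : 0 ≤ gaussMoment k u :=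
  intervalIntegral.integral_nonneg zero_le_one fun s hs => by
    have := hs.1
    positivity

lemma exists_gaussMoment_le (k : ℕ) :
    ∃ C : ℝ, 0 ≤ C ∧ ∀ u : ℝ, 0 ≤ u →
      gaussMoment k u ≤ C * (1 + u) ^ (-((k : ℝ) + 1 / 2)) := by
  refine ⟨Real.exp 1 * ((1 / 2) * Real.Gamma ((2 * k + 1) / 2)), ?_, fun u hu => ?_⟩
  · have := Real.Gamma_nonneg_of_nonneg (s := (2 * (k : ℝ) + 1) / 2) (by positivity)
    positivity
  have hu1 : 0 < 1 + u := by linarith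
  have hk : (-1 : ℝ) < 2 * k := by
    have : (0 : ℝ) ≤ k := k.cast_nonneg
    linarith
  have hint := integrableOn_rpow_mul_exp_neg_mul_rpow (s := 2 * k) (p := 2) (b := 1 + u)
    hk (by norm_num) hu1
  have hval := integral_rpow_mul_exp_neg_mul_rpow (q := 2 * k) (p := 2) (b := 1 + u)
    (by norm_num) hk hu1
  rw [gaussMoment, intervalIntegral.integral_of_le zero_le_one]
  calc ∫ s in Set.Ioc (0:ℝ) 1, s ^ (2 * k) * Real.exp (-s ^ 2 * u)
      ≤ ∫ s in Set.Ioc (0:ℝ) 1,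
          Real.exp 1 * (s ^ (2 * (k : ℝ)) * Real.exp (-(1 + u) * s ^ (2 : ℝ))) := by
        refine setIntegral_mono_on ?_ ?_ measurableSet_Ioc fun s hs => ?_
        · exact ((by fun_prop : Continuous fun s : ℝ =>
            s ^ (2 * k) * Real.exp (-s ^ 2 * u)).integrableOn_Icc).mono_set
              Set.Ioc_subset_Icc_self
        · exact (hint.mono_set fun s hs => hs.1).const_mul _
        · have e1 : s ^ (2 * (k : ℝ)) = s ^ (2 * k) := by
            rw [← Real.rpow_natCast]; push_cast; rfl
          have hs2 : s ^ 2 ≤ 1 := pow_le_one₀ hs.1.le hs.2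
          rw [e1, Real.rpow_two, mul_left_comm, ← Real.exp_add]
          have := hs.1
          gcongr
          nlinarith
    _ ≤ ∫ s in Set.Ioi (0:ℝ),
          Real.exp 1 * (s ^ (2 * (k : ℝ)) * Real.exp (-(1 + u) * s ^ (2 : ℝ))) := by
        refine setIntegral_mono_set (hint.const_mul _) ?_ ?_
        · filter_upwards [ae_restrict_mem measurableSet_Ioi] with s hs
          have : 0 < s := hs
          positivity
        · exact Filter.Eventually.of_forall fun s hs => hs.1
    _ = _ := by
        rw [integral_const_mul, hval]
        have : -(2 * (k : ℝ) + 1) / 2 = -((k : ℝ) + 1 / 2) := by ring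
        rw [this]
        ring

/-- Families `f a x` obtained from `a ^ k * gaussMoment k (a * ‖x‖ ^ 2)` by multiplication by
coordinates and linear combinations; the index `n` is the order of decay minus one, so that
each derivative raises it by one. -/
inductive IsGaussKernel : ℤ → (ℝ → EuclideanSpace ℝ (Fin 3) → ℝ) → Prop
  | moment (k : ℕ) :
      IsGaussKernel (2 * k) fun a x => a ^ k * gaussMoment k (a * ‖x‖ ^ 2)
  | coord_mul (i : Fin 3) {n : ℤ} {f : ℝ → EuclideanSpace ℝ (Fin 3) → ℝ} :
      IsGaussKernel n f → IsGaussKernel (n - 1) fun a x => x i * f a x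
  | add {n : ℤ} {f g : ℝ → EuclideanSpace ℝ (Fin 3) → ℝ} :
      IsGaussKernel n f → IsGaussKernel n g → IsGaussKernel n fun a x => f a x + g a x
  | const_mul (c : ℝ) {n : ℤ} {f : ℝ → EuclideanSpace ℝ (Fin 3) → ℝ} :
      IsGaussKernel n f → IsGaussKernel n fun a x => c * f a x

lemma hasFDerivAt_moment (k : ℕ) (a : ℝ) (x : EuclideanSpace ℝ (Fin 3)) :
    HasFDerivAt (fun y : EuclideanSpace ℝ (Fin 3) => a ^ k * gaussMoment k (a * ‖y‖ ^ 2))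
      (a ^ k • (-gaussMoment (k + 1) (a * ‖x‖ ^ 2)) • a • 2 • innerSL ℝ x) x := by
  have h1 := (hasStrictFDerivAt_norm_sq x).hasFDerivAt.const_mul a
  exact ((hasDerivAt_gaussMoment k (a * ‖x‖ ^ 2)).comp_hasFDerivAt x h1).const_mul (a ^ k)

lemma IsGaussKernel.differentiable {n : ℤ} {f : ℝ → EuclideanSpace ℝ (Fin 3) → ℝ}
    (hf : IsGaussKernel n f) (a : ℝ) : Differentiable ℝ (f a) := by
  induction hf with
  | moment k => exact fun x => (hasFDerivAt_moment k a x).differentiableAt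
  | coord_mul i _ ih =>
    exact (EuclideanSpace.proj (𝕜 := ℝ) i).differentiable.mul ih
  | add _ _ ihf ihg => exact ihf.add ihg
  | const_mul c _ ih => exact ih.const_mul c

lemma IsGaussKernel.exists_pd3 {n : ℤ} {f : ℝ → EuclideanSpace ℝ (Fin 3) → ℝ}
    (hf : IsGaussKernel n f) (i : Fin 3) :
    ∃ g, IsGaussKernel (n + 1) g ∧ ∀ a x, pd3 i (f a) x = g a x := by
  induction hf with
  | moment k =>
    refine ⟨fun a x => -2 * (x i * (a ^ (k + 1) * gaussMoment (k + 1) (a * ‖x‖ ^ 2))),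
      ?_, fun a x => ?_⟩
    · have h := ((IsGaussKernel.moment (k + 1)).coord_mul i).const_mul (-2)
      convert h using 1
      push_cast
      ring
    · rw [pd3, (hasFDerivAt_moment k a x).fderiv]
      simp [EuclideanSpace.inner_single_right]
      ring
  | @coord_mul j n f hf ih =>
    obtain ⟨g, hg, hgf⟩ := ih
    refine ⟨fun a x => x j * g a x +
      (EuclideanSpace.single i (1 : ℝ) : EuclideanSpace ℝ (Fin 3)) j * f a x, ?_, fun a x => ?_⟩
    · refine .add ?_ (.const_mul _ ?_)
      · convert hg.coord_mul j using 1
        ring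
      · simpa using hf
    · have h := ((EuclideanSpace.proj (𝕜 := ℝ) j).hasFDerivAt (x := x)).mul
        (hf.differentiable a x).hasFDerivAt
      simp only [← hgf, pd3]
      refine (congrArg (fun L => L (EuclideanSpace.single i (1 : ℝ))) h.fderiv).trans ?_
      simp [mul_comm]
  | add hf hg ihf ihg =>
    obtain ⟨f', hf', hff⟩ := ihf
    obtain ⟨g', hg', hgg⟩ := ihg
    refine ⟨_, hf'.add hg', fun a x => ?_⟩
    rw [← hff, ← hgg, pd3, pd3, pd3, fderiv_fun_add (hf.differentiable a x) (hg.differentiable a x)]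
    rfl
  | const_mul c hf ih =>
    obtain ⟨g, hg, hgf⟩ := ih
    refine ⟨_, hg.const_mul c, fun a x => ?_⟩
    rw [← hgf, pd3, pd3, fderiv_const_mul (hf.differentiable a x)]
    rfl

lemma IsGaussKernel.exists_bound {n : ℤ} {f : ℝ → EuclideanSpace ℝ (Fin 3) → ℝ}
    (hf : IsGaussKernel n f) :
    ∃ C : ℝ, 0 ≤ C ∧ ∀ a : ℝ, 0 < a → ∀ x,
      |f a x| ≤ C * a ^ (-(1 / 2) : ℝ) * (‖x‖ ^ 2 + a⁻¹) ^ (-((n : ℝ) + 1) / 2) := by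
  induction hf with
  | moment k =>
    obtain ⟨C, hC, h⟩ := exists_gaussMoment_le k
    refine ⟨C, hC, fun a ha x => ?_⟩
    have e : 1 + a * ‖x‖ ^ 2 = a * (‖x‖ ^ 2 + a⁻¹) := by field_simp; ring
    have hR : 0 ≤ ‖x‖ ^ 2 + a⁻¹ := by positivity
    have ea : a ^ k * a ^ (-((k : ℝ) + 1 / 2)) = a ^ (-(1 / 2) : ℝ) := by
      rw [← Real.rpow_natCast, ← Real.rpow_add ha]
      ring_nf
    have en : -(((2 * (k : ℤ) : ℤ) : ℝ) + 1) / 2 = -((k : ℝ) + 1 / 2) := by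
      push_cast; ring
    rw [abs_of_nonneg (mul_nonneg (by positivity) (gaussMoment_nonneg _ _)), en, ← ea]
    have h' := h (a * ‖x‖ ^ 2) (by positivity)
    rw [e, Real.mul_rpow ha.le hR] at h'
    calc a ^ k * gaussMoment k (a * ‖x‖ ^ 2) ≤ a ^ k * _ :=
          mul_le_mul_of_nonneg_left h' (by positivity)
      _ = _ := by ring
  | @coord_mul i n f _ ih =>
    obtain ⟨C, hC, h⟩ := ih
    refine ⟨C, hC, fun a ha x => ?_⟩
    have hR : 0 < ‖x‖ ^ 2 + a⁻¹ := by positivity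
    have hx : |x i| ≤ (‖x‖ ^ 2 + a⁻¹) ^ (1 / 2 : ℝ) := by
      rw [← Real.sqrt_eq_rpow]
      refine (PiLp.norm_apply_le x i).trans (Real.le_sqrt_of_sq_le ?_)
      have : 0 < a⁻¹ := by positivity
      linarith
    have e : (-(((n - 1 : ℤ) : ℝ) + 1) / 2) = 1 / 2 + -((n : ℝ) + 1) / 2 := by
      push_cast; ring
    rw [abs_mul, e, Real.rpow_add hR]
    calc |x i| * |f a x| ≤ _ := mul_le_mul hx (h a ha x) (abs_nonneg _) (by positivity)
      _ = _ := by ring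
  | add _ _ ihf ihg =>
    obtain ⟨C, hC, h⟩ := ihf
    obtain ⟨D, hD, h'⟩ := ihg
    refine ⟨C + D, add_nonneg hC hD, fun a ha x => ?_⟩
    rw [add_mul, add_mul]
    exact (abs_add_le _ _).trans (add_le_add (h a ha x) (h' a ha x))
  | const_mul c _ ih =>
    obtain ⟨C, hC, h⟩ := ih
    refine ⟨|c| * C, by positivity, fun a ha x => ?_⟩
    rw [abs_mul, mul_assoc, mul_assoc, ← mul_assoc C]
    exact mul_le_mul_of_nonneg_left (h a ha x) (abs_nonneg c)

lemma oseenG_eq_gaussMoment {ν t : ℝ} {x : EuclideanSpace ℝ (Fin 3)} (hx : x ≠ 0) :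
    oseenG ν t x = (Real.sqrt t)⁻¹ * gaussMoment 0 ((4 * ν * t)⁻¹ * ‖x‖ ^ 2) := by
  have hx' : ‖x‖ ≠ 0 := norm_ne_zero_iff.mpr hx
  have h := intervalIntegral.integral_comp_mul_left (a := 0) (b := 1)
    (fun ρ : ℝ => Real.exp (-ρ ^ 2 / (4 * ν * t)) / Real.sqrt t) hx'
  rw [mul_zero, mul_one, smul_eq_mul] at h
  rw [oseenG, one_div, ← h, intervalIntegral.integral_div, gaussMoment, div_eq_inv_mul]
  congr 2
  ext s
  simp only [mul_zero, pow_zero, one_mul]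
  congr 1
  ring

/-- Off the origin, `g t` is a rescaled Gaussian kernel of index `n` with parameter
`a = 1 / (4νt)`. -/
def IsOseenKernel (ν : ℝ) (n : ℤ) (g : ℝ → EuclideanSpace ℝ (Fin 3) → ℝ) : Prop :=
  ∃ f, IsGaussKernel n f ∧ ∀ t x, x ≠ 0 → g t x = (Real.sqrt t)⁻¹ * f (4 * ν * t)⁻¹ x

lemma isOseenKernel_oseenG (ν : ℝ) : IsOseenKernel ν 0 (oseenG ν) :=
  ⟨_, .moment 0, fun t x hx => by simpa using oseenG_eq_gaussMoment hx⟩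

lemma IsOseenKernel.pd3 {ν : ℝ} {n : ℤ} {g : ℝ → EuclideanSpace ℝ (Fin 3) → ℝ}
    (hg : IsOseenKernel ν n g) (i : Fin 3) :
    IsOseenKernel ν (n + 1) fun t => pd3 i (g t) := by
  obtain ⟨f, hf, hgf⟩ := hg
  obtain ⟨f', hf', hff⟩ := hf.exists_pd3 i
  refine ⟨f', hf', fun t x hx => ?_⟩
  have hev : g t =ᶠ[nhds x] fun y => (Real.sqrt t)⁻¹ * f (4 * ν * t)⁻¹ y := by
    filter_upwards [isOpen_ne.mem_nhds hx] with y hy using hgf t y hy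
  simp only [← hff, _root_.pd3]
  rw [hev.fderiv_eq, fderiv_const_mul (hf.differentiable _ x)]
  rfl

lemma IsOseenKernel.iterate_pd3 {ν : ℝ} {n : ℤ} {g : ℝ → EuclideanSpace ℝ (Fin 3) → ℝ}
    (hg : IsOseenKernel ν n g) (i : Fin 3) (k : ℕ) :
    IsOseenKernel ν (n + k) fun t => (_root_.pd3 i)^[k] (g t) := by
  induction k with
  | zero => simpa using hg
  | succ k ih =>
    simp only [Function.iterate_succ_apply']
    convert ih.pd3 i using 1
    push_cast
    ring

lemma IsOseenKernel.mpd3 {ν : ℝ} {n : ℤ} {g : ℝ → EuclideanSpace ℝ (Fin 3) → ℝ}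
    (hg : IsOseenKernel ν n g) (α : Fin 3 → ℕ) :
    IsOseenKernel ν (n + (α 0 + α 1 + α 2 : ℕ)) fun t => mpd3 α (g t) := by
  have h := ((hg.iterate_pd3 2 (α 2)).iterate_pd3 1 (α 1)).iterate_pd3 0 (α 0)
  have e : n + (α 0 + α 1 + α 2 : ℕ) = n + α 2 + α 1 + α 0 := by
    push_cast
    ring
  rw [e]
  exact h

lemma IsOseenKernel.exists_bound {ν : ℝ} (hν : 0 < ν) {n : ℕ}
    {g : ℝ → EuclideanSpace ℝ (Fin 3) → ℝ} (hg : IsOseenKernel ν n g) :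
    ∃ C : ℝ, 0 ≤ C ∧ ∀ t : ℝ, 0 < t → ∀ x, x ≠ 0 →
      |g t x| ≤ C / (‖x‖ ^ 2 + ν * t) ^ (((n : ℝ) + 1) / 2) := by
  obtain ⟨f, hf, hgf⟩ := hg
  obtain ⟨C, hC, h⟩ := hf.exists_bound
  refine ⟨C * Real.sqrt (4 * ν), by positivity, fun t ht x hx => ?_⟩
  have hνt : 0 < ν * t := mul_pos hν ht
  have hb := h (4 * ν * t)⁻¹ (by positivity) x
  have ea : ((4 * ν * t)⁻¹) ^ (-(1 / 2) : ℝ) = Real.sqrt (4 * ν) * Real.sqrt t := by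
    rw [Real.inv_rpow (by positivity), Real.rpow_neg (by positivity), inv_inv,
      ← Real.sqrt_eq_rpow, Real.sqrt_mul (by positivity)]
  have hR : (‖x‖ ^ 2 + 4 * ν * t) ^ (-((n : ℝ) + 1) / 2) ≤
      (‖x‖ ^ 2 + ν * t) ^ (-((n : ℝ) + 1) / 2) := by
    refine Real.rpow_le_rpow_of_nonpos (by positivity) (by linarith) ?_
    have : (0 : ℝ) ≤ n := n.cast_nonneg
    linarith
  have hst : 0 < Real.sqrt t := Real.sqrt_pos.mpr ht
  rw [hgf t x hx, abs_mul, abs_of_pos (inv_pos.mpr hst)]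
  rw [ea, inv_inv, Int.cast_natCast] at hb
  calc (Real.sqrt t)⁻¹ * |f (4 * ν * t)⁻¹ x|
      ≤ (Real.sqrt t)⁻¹ * (C * (Real.sqrt (4 * ν) * Real.sqrt t) *
          (‖x‖ ^ 2 + ν * t) ^ (-((n : ℝ) + 1) / 2)) := by
        gcongr
        exact hb.trans (mul_le_mul_of_nonneg_left hR (by positivity))
    _ = _ := by
        rw [neg_div, Real.rpow_neg (by positivity)]
        field_simp

/-- Higher-order estimates for the Oseen tensor: for every multi-index `α` with
`|α| = m`, `|∂^α ∂²G/∂xᵢ∂xⱼ(t,x)| ≤ C_m/(|x|²+νt)^{(m+3)/2}` with `C_m` depending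
only on `ν` and `m`. -/
theorem oseen_tensor_higher_estimates (ν : ℝ) (hν : 0 < ν)
    (m : ℕ) (α : Fin 3 → ℕ) (hα : α 0 + α 1 + α 2 = m) :
    ∃ C : ℝ, 0 < C ∧ ∀ i j : Fin 3, ∀ t : ℝ, 0 < t →
      ∀ x : EuclideanSpace ℝ (Fin 3), x ≠ 0 →
        |mpd3 α (pd3 i (pd3 j (oseenG ν t))) x| ≤
          C / (‖x‖ ^ 2 + ν * t) ^ (((m:ℝ) + 3) / 2) := by
  have hker : ∀ p : Fin 3 × Fin 3, IsOseenKernel ν ((m + 2 : ℕ) : ℤ)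
      fun t => mpd3 α (pd3 p.1 (pd3 p.2 (oseenG ν t))) := fun p => by
    convert (((isOseenKernel_oseenG ν).pd3 p.2).pd3 p.1).mpd3 α using 1
    rw [hα]
    push_cast
    ring
  choose C hC h using fun p => (hker p).exists_bound hν
  refine ⟨∑ p, C p + 1, add_pos_of_nonneg_of_pos (Finset.sum_nonneg fun p _ => hC p) one_pos,
    fun i j t ht x hx => (h (i, j) t ht x hx).trans ?_⟩
  have hle : C (i, j) ≤ ∑ p, C p + 1 :=
    (Finset.single_le_sum (fun p _ => hC p) (Finset.mem_univ (i, j))).trans (by linarith)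
  have e : (((m + 2 : ℕ) : ℝ) + 1) / 2 = ((m : ℝ) + 3) / 2 := by
    push_cast; ring
  rw [e]
  have : 0 < ν * t := mul_pos hν ht
  gcongr
end
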